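/- arXiv:2204.00615 — 8 statements merged into one kernel-verified Lean document; each statement's English description precedes it below -/
import Mathlib

section
/- Let f ∈ 𝒫. Define loft(f) := sup{ε ∈ [0,1] : f(x) = 1 for all x ∈ [0,ε], and f(x) > 1 − x + ε for all x ∈ (ε,1]}. Then: (a) 0 < loft(f) ≤ 1; (b) f(x) = 1 for every real x with 0 ≤ x ≤ loft(f); (c) f(x) + x − 1 ≥ loft(f) for every real x with loft(f) ≤ x ≤ 1; and (d) for every x ∈ [0,1], x ≥ f(x) + x − 1 ≥ min{x, loft(f)}. -/
open Filter Set

/-- `IsPWith f m ρ` : `f` belongs to the class `𝒫` with witness breakpoints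
`0 = ρ_0 < ρ_1 < ⋯ < ρ_{m+1} = 1` (rational): `f` maps `[0,1]` to `[0,1]`,
is weakly decreasing on `[0,1]`, is affine on each open interval
`(ρ_{i-1}, ρ_i)`, equals `1` on some interval `[0, ε)` with `ε > 0`,
satisfies `f(1) > 0`, and has right limits `> 1 - a` at every `a ∈ (0,1)`. -/
def IsPWith (f : ℝ → ℝ) (m : ℕ) (ρ : ℕ → ℚ) : Prop :=
  (∀ x ∈ Set.Icc (0:ℝ) 1, f x ∈ Set.Icc (0:ℝ) 1) ∧
  (∀ x y : ℝ, 0 ≤ x → x ≤ y → y ≤ 1 → f y ≤ f x) ∧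
  ρ 0 = 0 ∧ ρ (m + 1) = 1 ∧
  (∀ i j : ℕ, i < j → j ≤ m + 1 → ρ i < ρ j) ∧
  (∀ i : ℕ, 1 ≤ i → i ≤ m + 1 → ∃ a b : ℝ,
    ∀ x ∈ Set.Ioo ((ρ (i - 1) : ℝ)) ((ρ i : ℝ)), f x = a * x + b) ∧
  (∃ ε > (0:ℝ), ∀ x : ℝ, 0 ≤ x → x < ε → f x = 1) ∧
  0 < f 1 ∧
  (∀ a ∈ Set.Ioo (0:ℝ) 1, ∃ L : ℝ,
    Filter.Tendsto f (nhdsWithin a (Set.Ioi a)) (nhds L) ∧ 1 - a < L)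

/-- `f` belongs to the class `𝒫`. -/
def IsP (f : ℝ → ℝ) : Prop := ∃ (m : ℕ) (ρ : ℕ → ℚ), IsPWith f m ρ

/-- The loft of `f ∈ 𝒫`:
`loft(f) = sup{ε ∈ [0,1] : f ≡ 1 on [0,ε] and f(x) > 1 - x + ε on (ε,1]}`. -/
noncomputable def loft (f : ℝ → ℝ) : ℝ :=
  sSup {ε : ℝ | ε ∈ Set.Icc (0:ℝ) 1 ∧ (∀ x ∈ Set.Icc (0:ℝ) ε, f x = 1) ∧
    ∀ x ∈ Set.Ioc ε 1, 1 - x + ε < f x}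

/-- A weakly decreasing function on `[0,1]` with `f 1 > 0` and right limits `> 1 - a` stays
uniformly above `1 - x` on compact subintervals `[ε, 1]` of `(0, 1]`. -/
theorem exists_pos_forall_lt_add_sub_one {f : ℝ → ℝ}
    (hmono : ∀ x y : ℝ, 0 ≤ x → x ≤ y → y ≤ 1 → f y ≤ f x) (h1 : 0 < f 1)
    (hlim : ∀ a ∈ Ioo (0:ℝ) 1, ∃ L : ℝ, Tendsto f (nhdsWithin a (Ioi a)) (nhds L) ∧ 1 - a < L)
    {ε : ℝ} (hε : 0 < ε) :
    ∃ δ > 0, ∀ x ∈ Icc ε 1, δ < f x + x - 1 := by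
  refine isCompact_Icc.induction_on (p := fun s => ∃ δ > 0, ∀ x ∈ s, δ < f x + x - 1)
    ⟨1, one_pos, by simp⟩ ?_ ?_ ?_
  · rintro s t hst ⟨δ, hδ, h⟩
    exact ⟨δ, hδ, fun x hx => h x (hst hx)⟩
  · rintro s t ⟨δ, hδ, h⟩ ⟨δ', hδ', h'⟩
    refine ⟨min δ δ', lt_min hδ hδ', ?_⟩
    rintro x (hx | hx)
    · exact (min_le_left _ _).trans_lt (h x hx)
    · exact (min_le_right _ _).trans_lt (h' x hx)
  · rintro a ⟨ha, ha1⟩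
    suffices ∃ δ > 0, ∀ᶠ x in nhdsWithin a (Icc ε 1), δ < f x + x - 1 by
      obtain ⟨δ, hδ, h⟩ := this
      exact ⟨_, h, δ, hδ, fun x hx => hx⟩
    rcases ha1.eq_or_lt with rfl | ha1
    · refine ⟨f 1 / 2, half_pos h1, ?_⟩
      filter_upwards [self_mem_nhdsWithin,
        nhdsWithin_le_nhds (Ioi_mem_nhds (show 1 - f 1 / 2 < 1 by linarith))] with x hx hx'
      have := hmono x 1 (hε.le.trans hx.1) hx.2 le_rfl
      have : 1 - f 1 / 2 < x := hx'
      linarith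
    · obtain ⟨L, hL, haL⟩ := hlim a ⟨hε.trans_le ha, ha1⟩
      have hfa : L ≤ f a := by
        refine le_of_tendsto hL ?_
        filter_upwards [self_mem_nhdsWithin, nhdsWithin_le_nhds (Iio_mem_nhds ha1)] with x hx hx'
        exact hmono a x (hε.le.trans ha) (le_of_lt hx) (le_of_lt hx')
      have hright : ∀ᶠ x in nhds a, a < x → L - (L + a - 1) / 2 < f x :=
        eventually_nhdsWithin_iff.1 (hL.eventually (lt_mem_nhds (by linarith)))
      refine ⟨(L + a - 1) / 4, by linarith, ?_⟩
      filter_upwards [self_mem_nhdsWithin, nhdsWithin_le_nhds hright, nhdsWithin_le_nhds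
        (Ioi_mem_nhds (show a - (L + a - 1) / 4 < a by linarith))] with x hx hxr hx'
      have hx' : a - (L + a - 1) / 4 < x := hx'
      rcases le_or_gt x a with h | h
      · have := hmono x a (hε.le.trans hx.1) h ha1.le
        linarith
      · have := hxr h
        linarith

/-- basic properties of the loft of a function `f ∈ 𝒫`:
(a) `0 < loft f ≤ 1`; (b) `f(x) = 1` for `0 ≤ x ≤ loft f`;
(c) `f(x) + x - 1 ≥ loft f` for `loft f ≤ x ≤ 1`;
(d) `x ≥ f(x) + x - 1 ≥ min(x, loft f)` for all `x ∈ [0,1]`. -/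
theorem stmt2 (f : ℝ → ℝ) (hf : IsP f) :
    (0 < loft f ∧ loft f ≤ 1) ∧
    (∀ x : ℝ, 0 ≤ x → x ≤ loft f → f x = 1) ∧
    (∀ x : ℝ, loft f ≤ x → x ≤ 1 → loft f ≤ f x + x - 1) ∧
    (∀ x ∈ Set.Icc (0:ℝ) 1, f x + x - 1 ≤ x ∧ min x (loft f) ≤ f x + x - 1) := by
  obtain ⟨m, ρ, hrange, hmono, -, -, -, -, ⟨ε, hε, hone⟩, h1, hlim⟩ := hf
  set S := {ε : ℝ | ε ∈ Set.Icc (0:ℝ) 1 ∧ (∀ x ∈ Set.Icc (0:ℝ) ε, f x = 1) ∧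
    ∀ x ∈ Set.Ioc ε 1, 1 - x + ε < f x}
  have hloft : loft f = sSup S := rfl
  have hbdd : BddAbove S := ⟨1, fun _ h => h.1.2⟩
  obtain ⟨η, hηS, hη⟩ : ∃ η ∈ S, 0 < η := by
    obtain ⟨δ, hδ, hδf⟩ := exists_pos_forall_lt_add_sub_one hmono h1 hlim hε
    have hle₁ : min (ε / 2) (min δ 1) ≤ ε / 2 := min_le_left _ _
    have hle₂ : min (ε / 2) (min δ 1) ≤ δ := (min_le_right _ _).trans (min_le_left _ _)
    have hle₃ : min (ε / 2) (min δ 1) ≤ 1 := (min_le_right _ _).trans (min_le_right _ _)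
    have hpos : 0 < min (ε / 2) (min δ 1) := lt_min (half_pos hε) (lt_min hδ one_pos)
    refine ⟨_, ⟨⟨hpos.le, hle₃⟩, fun x hx => hone x hx.1 ?_, fun x hx => ?_⟩, hpos⟩
    · linarith [hx.2]
    · rcases lt_or_ge x ε with h | h
      · linarith [hone x (hpos.le.trans hx.1.le) h, hx.1]
      · linarith [hδf x ⟨h, hx.2⟩]
  have hpos : 0 < loft f := hη.trans_le (le_csSup hbdd hηS)
  have hle : loft f ≤ 1 := csSup_le ⟨η, hηS⟩ fun _ h => h.1.2
  have hbelow : ∀ x, 0 ≤ x → x < loft f → f x = 1 := by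
    intro x hx0 hx
    obtain ⟨e, he, hxe⟩ := exists_lt_of_lt_csSup ⟨η, hηS⟩ hx
    exact he.2.1 x ⟨hx0, hxe.le⟩
  have habove : ∀ x, loft f ≤ x → x ≤ 1 → loft f ≤ f x + x - 1 := by
    refine fun x hx hx1 => csSup_le ⟨η, hηS⟩ fun e he => ?_
    have hex : e ≤ x := (le_csSup hbdd he).trans hx
    rcases hex.eq_or_lt with rfl | hex
    · linarith [he.2.1 e ⟨he.1.1, le_rfl⟩]
    · linarith [he.2.2 x ⟨hex, hx1⟩]
  refine ⟨⟨hpos, hle⟩, fun x hx0 hx => ?_, habove, fun x hx => ⟨?_, ?_⟩⟩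
  · rcases hx.lt_or_eq with h | rfl
    · exact hbelow x hx0 h
    · exact le_antisymm (hrange _ ⟨hx0, hle⟩).2 (by linarith [habove _ le_rfl hle])
  · linarith [(hrange x hx).2]
  · rcases lt_or_ge x (loft f) with h | h
    · linarith [min_le_left x (loft f), hbelow x hx.1 h]
    · exact (min_le_right _ _).trans (habove x h hx.2)
end

section
/- Let f ∈ 𝒫 with rational breakpoints 0 = ρ_0 < ρ_1 < ⋯ < ρ_{m+1} = 1 as in the definition of 𝒫, and let B_f := ∫_0^1 log(f(x)+x−1) dx. Then there exists a constant C > 0 depending only on f such that for every positive integer N with N·ρ_i ∈ ℤ for all i, | log(#RP(λ(f,N))) − ( N·log N + B_f·N + (1/2)·log N ) | ≤ C. -/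
open Filter Set

/-- The number of rook placements of the shape `λ(f,N)`, where `λ(f,N)` is the
partition with `N` parts whose `i`-th part (1-based) is `⌈N·f(i/N)⌉`: permutations
`π` of `{1,…,N}` such that `π(i) ≤ λ(f,N)_{N+1-i}` for all `i`. -/
noncomputable def rpCount (f : ℝ → ℝ) (N : ℕ) : ℕ :=
  Nat.card {π : Equiv.Perm (Fin N) //
    ∀ i : Fin N, (π i : ℕ) + 1 ≤ ⌈(N : ℝ) * f (((N - (i : ℕ) : ℕ) : ℝ) / (N : ℝ))⌉₊}

/-- The number of injections whose `i`-th value is less than `b i`, for `b` monotone. -/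
theorem card_bounded_injective (b : ℕ → ℕ) (hb : Monotone b) {M : ℕ} (hM : ∀ i, b i ≤ M) (n : ℕ) :
    Nat.card {σ : Fin n → Fin M // Function.Injective σ ∧ ∀ i, (σ i : ℕ) < b i} =
      ∏ i ∈ Finset.range n, (b i - i) := by
  induction n with
  | zero =>
    rw [Finset.prod_range_zero, Nat.card_eq_one_iff_unique]
    exact ⟨inferInstance, ⟨⟨Fin.elim0, fun i => i.elim0, fun i => i.elim0⟩⟩⟩
  | succ n ih =>
    have e : {σ : Fin (n + 1) → Fin M // Function.Injective σ ∧ ∀ i, (σ i : ℕ) < b i} ≃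
        Σ σ : {σ : Fin n → Fin M // Function.Injective σ ∧ ∀ i, (σ i : ℕ) < b i},
          {x : Fin M // (x : ℕ) < b n ∧ x ∉ Set.range σ.1} :=
      { toFun := fun σ => ⟨⟨Fin.init σ.1, fun i j hij => by
            simpa using σ.2.1 hij, fun i => σ.2.2 i.castSucc⟩,
          ⟨σ.1 (Fin.last n), by simpa using σ.2.2 (Fin.last n), by
            rintro ⟨i, hi⟩
            exact (Fin.castSucc_lt_last i).ne (σ.2.1 hi)⟩⟩
        invFun := fun p => ⟨Fin.snoc (α := fun _ => Fin M) p.1.1 p.2.1,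
          Fin.snoc_injective_iff.2 ⟨p.1.2.1, p.2.2.2⟩, fun i => by
            refine Fin.lastCases ?_ (fun i => ?_) i
            · simpa using p.2.2.1
            · simpa using p.1.2.2 i⟩
        left_inv := fun σ => by simp
        right_inv := fun p => by
          rcases p with ⟨⟨σ, h1⟩, ⟨x, h2⟩⟩
          have h3 : Fin.init (α := fun _ => Fin M) (Fin.snoc (α := fun _ => Fin M) σ x) = σ :=
            Fin.init_snoc _ _
          refine Sigma.ext (Subtype.ext h3) ?_
          refine (Subtype.heq_iff_coe_eq fun y => ?_).2 (by simp)
          simp [h3] }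
    rw [Nat.card_congr e, Nat.card_sigma, Finset.prod_range_succ, ← ih]
    have key : ∀ σ : {σ : Fin n → Fin M // Function.Injective σ ∧ ∀ i, (σ i : ℕ) < b i},
        Nat.card {x : Fin M // (x : ℕ) < b n ∧ x ∉ Set.range σ.1} = b n - n := by
      rintro ⟨σ, hinj, hlt⟩
      classical
      rw [Nat.card_eq_fintype_card, Fintype.card_subtype]
      have h1 : (Finset.univ.filter fun x : Fin M => (x : ℕ) < b n ∧ x ∉ Set.range σ) =
          (Finset.univ.filter fun x : Fin M => (x : ℕ) < b n) \ Finset.univ.image σ := by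
        ext x
        simp
      have h2 : Finset.univ.image σ ⊆ Finset.univ.filter fun x : Fin M => (x : ℕ) < b n := by
        intro x hx
        obtain ⟨i, -, rfl⟩ := Finset.mem_image.1 hx
        simpa using (hlt i).trans_le (hb i.2.le)
      rw [h1, Finset.card_sdiff_of_subset h2, Finset.card_image_of_injective _ hinj,
        Fin.card_filter_val_lt]
      simp [hM n]
    rw [Finset.sum_congr rfl fun σ _ => key σ]
    simp [Nat.card_eq_fintype_card]

/-- The number of permutations whose `i`-th value is less than `b i`, for `b` monotone. -/
theorem card_bounded_perm (b : ℕ → ℕ) (hb : Monotone b) {N : ℕ} (hN : ∀ i, b i ≤ N) :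
    Nat.card {π : Equiv.Perm (Fin N) // ∀ i : Fin N, (π i : ℕ) + 1 ≤ b i} =
      ∏ i ∈ Finset.range N, (b i - i) := by
  rw [← card_bounded_injective b hb hN N]
  refine Nat.card_congr
    { toFun := fun π => ⟨π.1, π.1.injective, fun i => π.2 i⟩
      invFun := fun σ => ⟨Equiv.ofBijective σ.1 (Finite.injective_iff_bijective.1 σ.2.1),
        fun i => σ.2.2 i⟩
      left_inv := fun π => by ext; rfl
      right_inv := fun σ => by rfl }

/-- Stirling's formula for `log N!` with a bounded error. -/
theorem abs_log_factorial_sub_le : ∃ C : ℝ, ∀ N : ℕ, 0 < N →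
    |Real.log (N.factorial) - ((N : ℝ) * Real.log N - N + 1 / 2 * Real.log N)| ≤ C := by
  have hpi : (0 : ℝ) < √Real.pi := Real.sqrt_pos.2 Real.pi_pos
  have ht := (Real.continuousAt_log hpi.ne').tendsto.comp Stirling.tendsto_stirlingSeq_sqrt_pi
  obtain ⟨C, hC⟩ := (Metric.isBounded_range_of_tendsto _ ht).exists_norm_le
  refine ⟨C + Real.log 2 / 2, fun N hN => ?_⟩
  have h1 : |Real.log (Stirling.stirlingSeq N)| ≤ C := hC _ ⟨N, rfl⟩
  have hN' : (0 : ℝ) < N := by exact_mod_cast hN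
  rw [Stirling.log_stirlingSeq_formula] at h1
  rw [Real.log_mul two_ne_zero hN'.ne', Real.log_div hN'.ne' (Real.exp_pos _).ne',
    Real.log_exp] at h1
  have h2 : 0 < Real.log 2 := Real.log_pos one_lt_two
  rw [abs_le] at h1 ⊢
  constructor <;> linarith [h1.1, h1.2]

/-- If the increments of `h` are dominated by those of `φ` on `[0, 1]`, then the right Riemann sums
of `h` approximate its integral with error at most the increment of `φ`, divided by `N`. -/
theorem abs_sum_sub_integral_le {h φ : ℝ → ℝ}
    (hφ : ∀ x y, 0 ≤ x → x ≤ y → y ≤ 1 → |h x - h y| ≤ φ y - φ x) :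
    IntervalIntegrable h MeasureTheory.volume 0 1 ∧ ∀ N : ℕ, 0 < N →
      |∑ k ∈ Finset.range N, h (((k + 1 : ℕ) : ℝ) / N) - N * ∫ x in (0 : ℝ)..1, h x| ≤
        φ 1 - φ 0 := by
  have hint : IntervalIntegrable h MeasureTheory.volume 0 1 := by
    have m1 : MonotoneOn φ (uIcc 0 1) := by
      rw [uIcc_of_le zero_le_one]
      intro x hx y hy hxy
      linarith [hφ x y hx.1 hxy hy.2, abs_nonneg (h x - h y)]
    have m2 : MonotoneOn (fun x => φ x - h x) (uIcc 0 1) := by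
      rw [uIcc_of_le zero_le_one]
      intro x hx y hy hxy
      have := neg_abs_le (h x - h y)
      simp only
      linarith [hφ x y hx.1 hxy hy.2]
    exact (m1.intervalIntegrable.sub m2.intervalIntegrable).congr (by intro x _; simp)
  refine ⟨hint, fun N hN => ?_⟩
  have hN' : (0 : ℝ) < N := by exact_mod_cast hN
  have hsub : ∀ k < N, IntervalIntegrable h MeasureTheory.volume ((k : ℕ) / (N : ℝ))
      ((k + 1 : ℕ) / (N : ℝ)) := by
    intro k hk
    refine hint.mono_set ?_
    rw [uIcc_of_le zero_le_one, uIcc_of_le (by gcongr; simp)]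
    refine Icc_subset_Icc (by positivity) ?_
    rw [div_le_one hN']
    exact_mod_cast hk
  have hsum := intervalIntegral.sum_integral_adjacent_intervals
    (a := fun k : ℕ => (k : ℝ) / (N : ℝ)) hsub
  simp only [Nat.cast_zero, zero_div, div_self hN'.ne'] at hsum
  rw [← hsum, Finset.mul_sum, ← Finset.sum_sub_distrib]
  have hterm : ∀ k ∈ Finset.range N,
      |h (((k + 1 : ℕ) : ℝ) / N) - N * ∫ x in ((k : ℕ) / (N : ℝ))..((k + 1 : ℕ) / (N : ℝ)), h x| ≤
        φ (((k + 1 : ℕ) : ℝ) / N) - φ ((k : ℝ) / N) := by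
    intro k hk
    have hk := Finset.mem_range.1 hk
    have hle : (k : ℝ) / N ≤ ((k + 1 : ℕ) : ℝ) / N := by gcongr; simp
    have h0 : (0 : ℝ) ≤ k / N := by positivity
    have h1 : ((k + 1 : ℕ) : ℝ) / N ≤ 1 := by
      rw [div_le_one hN']
      exact_mod_cast hk
    set u := (k : ℝ) / N
    set v := ((k + 1 : ℕ) : ℝ) / N with hv
    have huv : v - u = 1 / N := by simp only [u, v]; push_cast; ring
    have hb : ‖∫ x in u..v, (h v - h x)‖ ≤ (φ v - φ u) * |v - u| := by
      refine intervalIntegral.norm_integral_le_of_norm_le_const fun x hx => ?_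
      rw [uIoc_of_le hle] at hx
      have a1 := hφ x v (h0.trans hx.1.le) hx.2 h1
      have a2 := hφ u x h0 hx.1.le (hx.2.trans h1)
      rw [Real.norm_eq_abs, abs_sub_comm]
      linarith [abs_nonneg (h u - h x)]
    rw [intervalIntegral.integral_sub (by simp) (hsub k hk), intervalIntegral.integral_const,
      huv, Real.norm_eq_abs, abs_of_pos (show (0 : ℝ) < 1 / N by positivity), smul_eq_mul] at hb
    have : h v - N * ∫ x in u..v, h x = N * (1 / N * h v - ∫ x in u..v, h x) := by
      field_simp
    rw [this, abs_mul, abs_of_pos hN']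
    calc _ ≤ N * ((φ v - φ u) * (1 / N)) := by gcongr
      _ = _ := by field_simp
  refine (Finset.abs_sum_le_sum_abs _ _).trans ((Finset.sum_le_sum hterm).trans ?_)
  rw [Finset.sum_range_sub (fun k : ℕ => φ ((k : ℝ) / N))]
  simp [div_self hN'.ne']

theorem exists_pos_le_add_sub_one {f : ℝ → ℝ} {c : ℝ} (hc : 0 < c)
    (hanti : ∀ x y : ℝ, 0 ≤ x → x ≤ y → y ≤ 1 → f y ≤ f x) (h1 : 0 < f 1)
    (hlim : ∀ a ∈ Set.Ioo (0:ℝ) 1, ∃ L : ℝ,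
      Filter.Tendsto f (nhdsWithin a (Set.Ioi a)) (nhds L) ∧ 1 - a < L) :
    ∃ δ > 0, ∀ x, c ≤ x → x ≤ 1 → δ ≤ f x + x - 1 := by
  suffices H : ∃ δ > 0, ∀ x ∈ Icc c 1, δ ≤ f x + x - 1 by
    obtain ⟨δ, h, H⟩ := H
    exact ⟨δ, h, fun x hx hx1 => H x ⟨hx, hx1⟩⟩
  refine (isCompact_Icc (a := c) (b := (1 : ℝ))).induction_on
    (p := fun s => ∃ δ > 0, ∀ x ∈ s, δ ≤ f x + x - 1) ⟨1, one_pos, by simp⟩ ?_ ?_ ?_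
  · rintro s t hst ⟨δ, hδ, h⟩
    exact ⟨δ, hδ, fun x hx => h x (hst hx)⟩
  · rintro s t ⟨δ, hδ, h⟩ ⟨η, hη, h'⟩
    refine ⟨min δ η, lt_min hδ hη, ?_⟩
    rintro x (hx | hx)
    · exact (min_le_left _ _).trans (h x hx)
    · exact (min_le_right _ _).trans (h' x hx)
  · rintro a ⟨hca, ha1⟩
    have left : 0 < f a + a - 1 →
        ∀ᶠ x in nhds a, c ≤ x → x ≤ a → (f a + a - 1) / 2 ≤ f x + x - 1 := by
      intro hpos
      filter_upwards [lt_mem_nhds (show a - (f a + a - 1) / 2 < a by linarith)] with x hx hcx hxa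
      linarith [hanti x a (hc.le.trans hcx) hxa ha1]
    rcases ha1.eq_or_lt with rfl | ha1
    · refine ⟨_, inter_mem_nhdsWithin _ (left (by linarith)), (f 1 + 1 - 1) / 2, by linarith, ?_⟩
      rintro x ⟨⟨hx1, hx2⟩, hx⟩
      exact hx hx1 hx2
    · obtain ⟨L, hL, hLa⟩ := hlim a ⟨hc.trans_le hca, ha1⟩
      have hfa : L ≤ f a := by
        refine le_of_tendsto hL ?_
        filter_upwards [Ioo_mem_nhdsGT ha1] with x hx
        exact hanti a x (hc.le.trans hca) hx.1.le hx.2.le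
      have right := eventually_nhdsWithin_iff.1
        (hL.eventually (lt_mem_nhds (show (L + (1 - a)) / 2 < L by linarith)))
      refine ⟨_, inter_mem_nhdsWithin _ (right.and (left (by linarith))),
        (L + a - 1) / 2, by linarith, ?_⟩
      rintro x ⟨⟨hx1, hx2⟩, hxr, hxl⟩
      rcases le_or_gt x a with hxa | hxa
      · linarith [hxl hx1 hxa]
      · linarith [hxr hxa]

theorem abs_log_sub_log_le {δ x y : ℝ} (hδ : 0 < δ) (hx : δ ≤ x) (hy : δ ≤ y) :
    |Real.log x - Real.log y| ≤ |x - y| / δ := by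
  wlog h : y ≤ x generalizing x y
  · rw [abs_sub_comm, abs_sub_comm x]
    exact this hy hx (le_of_not_ge h)
  have hy0 := hδ.trans_le hy
  have hx0 := hδ.trans_le hx
  rw [abs_of_nonneg (sub_nonneg.2 (Real.log_le_log hy0 h)), abs_of_nonneg (sub_nonneg.2 h),
    ← Real.log_div hx0.ne' hy0.ne']
  calc Real.log (x / y) ≤ x / y - 1 := Real.log_le_sub_one_of_pos (by positivity)
    _ = (x - y) / y := by field_simp
    _ ≤ (x - y) / δ := by
      have := sub_nonneg.2 h
      gcongr

theorem abs_log_sub_log_le_of_antitone {f : ℝ → ℝ} {c ε δ : ℝ} (hc : 0 < c) (hcε : c < ε)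
    (hδ : 0 < δ) (hanti : ∀ x y : ℝ, 0 ≤ x → x ≤ y → y ≤ 1 → f y ≤ f x)
    (hone : ∀ x : ℝ, 0 ≤ x → x < ε → f x = 1)
    (hlow : ∀ x, c ≤ x → x ≤ 1 → δ ≤ f x + x - 1) {x y : ℝ} (hx : 0 ≤ x) (hxy : x ≤ y)
    (hy : y ≤ 1) :
    |(Real.log (f x + x - 1) - Real.log x) - (Real.log (f y + y - 1) - Real.log y)| ≤
      (1 / δ + 1 / c) * (y - f y) - (1 / δ + 1 / c) * (x - f x) := by
  have hzero : ∀ z, 0 ≤ z → z < ε → Real.log (f z + z - 1) - Real.log z = 0 := by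
    intro z hz hz'
    rw [hone z hz hz', add_sub_cancel_left, sub_self]
  have hlarge : ∀ u, c ≤ u → u ≤ y →
      |(Real.log (f u + u - 1) - Real.log u) - (Real.log (f y + y - 1) - Real.log y)| ≤
      (1 / δ + 1 / c) * ((y - f y) - (u - f u)) := by
    intro u hu huy
    have h1 := abs_log_sub_log_le hδ (hlow u hu (huy.trans hy)) (hlow y (hu.trans huy) hy)
    have h2 := abs_log_sub_log_le hc hu (hu.trans huy)
    have hf := hanti u y (hc.le.trans hu) huy hy
    have h3 : |f u + u - 1 - (f y + y - 1)| ≤ (y - f y) - (u - f u) := by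
      rw [abs_le]; constructor <;> linarith
    have h4 : |u - y| ≤ (y - f y) - (u - f u) := by
      rw [abs_le]; constructor <;> linarith
    calc _ = |(Real.log (f u + u - 1) - Real.log (f y + y - 1)) - (Real.log u - Real.log y)| := by
          congr 1; ring
      _ ≤ |Real.log (f u + u - 1) - Real.log (f y + y - 1)| + |Real.log u - Real.log y| :=
        abs_sub _ _
      _ ≤ ((y - f y) - (u - f u)) / δ + ((y - f y) - (u - f u)) / c :=
        add_le_add (h1.trans (by gcongr)) (h2.trans (by gcongr))
      _ = _ := by ring
  rw [← mul_sub]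
  have hfxy := hanti x y hx hxy hy
  rcases le_or_gt c x with hcx | hcx
  · exact hlarge x hcx hxy
  · rcases lt_or_ge y c with hyc | hyc
    · rw [hzero x hx (hcx.trans hcε), hzero y (hx.trans hxy) (hyc.trans hcε), sub_zero, abs_zero]
      exact mul_nonneg (by positivity) (by linarith)
    · rw [hzero x hx (hcx.trans hcε), ← hzero c hc.le hcε]
      refine (hlarge c le_rfl hyc).trans ?_
      have := hanti x c hx hcx.le (hyc.trans hy)
      gcongr

theorem abs_log_natCeil_sub_log_le {t δ : ℝ} (hδ : 0 < δ) (ht : δ ≤ t) :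
    |Real.log (⌈t⌉₊ : ℝ) - Real.log t| ≤ 1 / δ := by
  have h1 := Nat.le_ceil t
  refine (abs_log_sub_log_le hδ (ht.trans h1) ht).trans ?_
  have h2 := Nat.ceil_lt_add_one (hδ.le.trans ht)
  rw [abs_of_nonneg (by linarith)]
  gcongr
  linarith

/-- The product formula for the number of rook placements. -/
theorem rpCount_eq_prod {f : ℝ → ℝ} (hmem : ∀ x ∈ Set.Icc (0:ℝ) 1, f x ∈ Set.Icc (0:ℝ) 1)
    (hanti : ∀ x y : ℝ, 0 ≤ x → x ≤ y → y ≤ 1 → f y ≤ f x) {N : ℕ} (hN : 0 < N) :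
    rpCount f N = ∏ k ∈ Finset.range N,
      ⌈(N : ℝ) * (f (((k + 1 : ℕ) : ℝ) / N) + ((k + 1 : ℕ) : ℝ) / N - 1)⌉₊ := by
  have hN' : (0 : ℝ) < N := by exact_mod_cast hN
  have hle : ∀ i : ℕ, ((N - i : ℕ) : ℝ) / N ≤ 1 := by
    intro i
    rw [div_le_one hN']
    exact_mod_cast Nat.sub_le _ _
  rw [rpCount, card_bounded_perm (fun i => ⌈(N : ℝ) * f (((N - i : ℕ) : ℝ) / (N : ℝ))⌉₊),
    ← Finset.prod_range_reflect]
  · refine Finset.prod_congr rfl fun k hk => ?_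
    have hk := Finset.mem_range.1 hk
    have h1 : N - (N - 1 - k) = k + 1 := by omega
    have h2 : ((N - 1 - k : ℕ) : ℝ) = N - (k + 1 : ℕ) := by
      rw [eq_sub_iff_add_eq]
      exact_mod_cast show N - 1 - k + (k + 1) = N by omega
    rw [h1, ← Nat.ceil_sub_natCast, h2]
    congr 1
    field_simp
    ring
  · intro i j hij
    refine Nat.ceil_mono ?_
    refine mul_le_mul_of_nonneg_left (hanti _ _ (by positivity) ?_ (hle _)) hN'.le
    gcongr
  · intro i
    rw [Nat.ceil_le]
    exact mul_le_of_le_one_right hN'.le (hmem _ ⟨by positivity, hle i⟩).2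

/-- for `f ∈ 𝒫` with breakpoints `ρ_0, …, ρ_{m+1}` and
`B_f = ∫_0^1 log(f(x)+x−1) dx` (interpreted as `lim_{ε↘0} ∫_ε^1`), there is a
constant `C > 0` depending only on `f` such that for every positive integer `N`
with `N·ρ_i ∈ ℤ` for all `i`,
`|log #RP(λ(f,N)) − (N·log N + B_f·N + (1/2)·log N)| ≤ C`. -/
theorem stmt4 (f : ℝ → ℝ) (m : ℕ) (ρ : ℕ → ℚ) (hf : IsPWith f m ρ) (B : ℝ)
    (hB : Filter.Tendsto (fun ε : ℝ => ∫ x in ε..1, Real.log (f x + x - 1))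
      (nhdsWithin 0 (Set.Ioi 0)) (nhds B)) :
    ∃ C : ℝ, 0 < C ∧
      ∀ N : ℕ, 0 < N → (∀ i : ℕ, i ≤ m + 1 → ∃ z : ℤ, (N : ℚ) * ρ i = (z : ℚ)) →
        |Real.log (rpCount f N)
          - ((N : ℝ) * Real.log N + B * N + (1 / 2) * Real.log N)| ≤ C := by
  obtain ⟨hmem, hanti, -, -, -, -, ⟨ε, hε, hone⟩, h1, hlim⟩ := hf
  have hc : 0 < ε / 2 := by linarith
  have hcε : ε / 2 < ε := by linarith
  obtain ⟨δ, hδ, hlow⟩ := exists_pos_le_add_sub_one hc hanti h1 hlim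
  have hpos : ∀ x, 0 < x → x ≤ 1 → 0 < f x + x - 1 := by
    intro x hx hx1
    rcases lt_or_ge x ε with h | h
    · rw [hone x hx.le h]; linarith
    · linarith [hlow x (hcε.le.trans h) hx1]
  set h : ℝ → ℝ := fun x => Real.log (f x + x - 1) - Real.log x with hh
  obtain ⟨hint, hriemann⟩ := abs_sum_sub_integral_le (h := h)
    (φ := fun x => (1 / δ + 1 / (ε / 2)) * (x - f x))
    fun x y hx hxy hy => abs_log_sub_log_le_of_antitone hc hcε hδ hanti hone hlow hx hxy hy
  have hBeq : B = (∫ x in (0 : ℝ)..1, h x) - 1 := by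
    have hgint : IntervalIntegrable (fun x => Real.log (f x + x - 1)) MeasureTheory.volume 0 1 :=
      (hint.add intervalIntegral.intervalIntegrable_log').congr (by intro x _; simp [hh])
    have hval : ∫ x in (0 : ℝ)..1, h x = (∫ x in (0 : ℝ)..1, Real.log (f x + x - 1)) + 1 := by
      rw [intervalIntegral.integral_sub hgint intervalIntegral.intervalIntegrable_log',
        integral_log]
      simp
    have hcont := intervalIntegral.continuousOn_primitive_interval_left (a := 0) (b := 1)
      (by rw [uIcc_of_le zero_le_one]
          exact (intervalIntegrable_iff_integrableOn_Icc_of_le zero_le_one).1 hgint)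
    rw [uIcc_of_le zero_le_one] at hcont
    have ht := ((hcont 0 (by simp)).mono Ioc_subset_Icc_self).tendsto
    rw [nhdsWithin_Ioc_eq_nhdsGT zero_lt_one] at ht
    rw [hval, tendsto_nhds_unique hB ht]
    ring
  obtain ⟨S, hS⟩ := abs_log_factorial_sub_le
  refine ⟨max 1 (1 / δ + ((1 / δ + 1 / (ε / 2)) * (1 - f 1) - (1 / δ + 1 / (ε / 2)) * (0 - f 0))
    + S), by positivity, fun N hN _ => (le_max_of_le_right ?_)⟩
  have hN' : (0 : ℝ) < N := by exact_mod_cast hN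
  have hx : ∀ k ∈ Finset.range N,
      0 < ((k + 1 : ℕ) : ℝ) / N ∧ ((k + 1 : ℕ) : ℝ) / N ≤ 1 := by
    intro k hk
    refine ⟨by positivity, ?_⟩
    rw [div_le_one hN']
    exact_mod_cast Finset.mem_range.1 hk
  have hceil : |Real.log (rpCount f N) -
      ∑ k ∈ Finset.range N, (h (((k + 1 : ℕ) : ℝ) / N) + Real.log ((k + 1 : ℕ) : ℝ))| ≤ 1 / δ := by
    rw [rpCount_eq_prod hmem hanti hN, Nat.cast_prod, Real.log_prod, ← Finset.sum_sub_distrib]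
    · refine (Finset.abs_sum_le_sum_abs _ _).trans ((Finset.sum_le_card_nsmul _ _ (1 / (N * δ))
        fun k hk => ?_).trans (le_of_eq ?_))
      · obtain ⟨hx0, hx1⟩ := hx k hk
        have hk0 : ((k + 1 : ℕ) : ℝ) ≠ 0 := by positivity
        have hlog : h (((k + 1 : ℕ) : ℝ) / N) + Real.log ((k + 1 : ℕ) : ℝ) = Real.log
            ((N : ℝ) * (f (((k + 1 : ℕ) : ℝ) / N) + ((k + 1 : ℕ) : ℝ) / N - 1)) := by
          rw [Real.log_mul hN'.ne' (hpos _ hx0 hx1).ne']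
          simp only [hh]
          rw [Real.log_div hk0 hN'.ne']
          ring
        rw [hlog]
        rcases lt_or_ge (((k + 1 : ℕ) : ℝ) / N) ε with hlt | hge
        · rw [hone _ hx0.le hlt, add_sub_cancel_left, mul_div_cancel₀ _ hN'.ne', Nat.ceil_natCast,
            sub_self, abs_zero]
          positivity
        · exact abs_log_natCeil_sub_log_le (by positivity)
            (mul_le_mul_of_nonneg_left (hlow _ (hcε.le.trans hge) hx1) hN'.le)
      · rw [Finset.card_range, nsmul_eq_mul]
        field_simp
    · intro k hk
      have := Nat.ceil_pos.2 (mul_pos hN' (hpos _ (hx k hk).1 (hx k hk).2))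
      exact_mod_cast this.ne'
  have hfact : ∑ k ∈ Finset.range N, Real.log ((k + 1 : ℕ) : ℝ) = Real.log N.factorial := by
    rw [← Finset.prod_range_add_one_eq_factorial, Nat.cast_prod, Real.log_prod]
    intro k _
    positivity
  rw [Finset.sum_add_distrib, hfact] at hceil
  have hr := hriemann N hN
  have hs := hS N hN
  rw [hBeq]
  simp only [abs_le] at hceil hr hs ⊢
  constructor <;> linarith [hceil.1, hceil.2, hr.1, hr.2, hs.1, hs.2]
end

section
/- Fix a real p ≥ 1. For every f ∈ 𝒫 there exists a sequence of functions g_n ∈ 𝒫 such that ∫_0^1 |g_n(x) − f(x)|^p dx → 0 as n → ∞, while B_{g_n} → −∞ as n → ∞. In particular, the map f ↦ B_f from (𝒫, L^p) to ℝ is discontinuous at every point of 𝒫. -/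
open Filter Set

open MeasureTheory

theorem intervalIntegrable_log_affine (a b u v : ℝ) :
    IntervalIntegrable (fun x : ℝ => Real.log (a * x + b)) volume u v := by
  rcases eq_or_ne a 0 with rfl | ha
  · simp
  · have h : IntervalIntegrable (fun x : ℝ => Real.log (x + b)) volume (a * u) (a * v) := by
      have h := (intervalIntegral.intervalIntegrable_log' (a := a * u + b) (b := a * v + b)
        ).comp_add_right b
      simpa using h
    have h' := h.comp_mul_left (c := a)
    simpa [ha] using h'

theorem IsPWith.intervalIntegrable_log {f : ℝ → ℝ} {m : ℕ} {ρ : ℕ → ℚ} (hf : IsPWith f m ρ) :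
    IntervalIntegrable (fun x : ℝ => Real.log (f x + x - 1)) volume 0 1 := by
  obtain ⟨-, -, h0, h1, hlt, haff, -⟩ := hf
  have h := IntervalIntegrable.trans_iterate (f := fun x : ℝ => Real.log (f x + x - 1))
    (μ := volume) (a := fun i => (ρ i : ℝ)) (n := m + 1) ?_
  · simpa [h0, h1] using h
  intro k hk
  obtain ⟨a, b, hab⟩ := haff (k + 1) (by omega) (by omega)
  have hle : (ρ k : ℝ) ≤ ρ (k + 1) := by exact_mod_cast (hlt k (k + 1) (by omega) (by omega)).le
  have key := intervalIntegrable_log_affine (a + 1) (b - 1) (ρ k) (ρ (k + 1))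
  rw [intervalIntegrable_iff_integrableOn_Ioo_of_le hle] at key ⊢
  refine key.congr_fun (fun x hx => ?_) measurableSet_Ioo
  simp only [Nat.add_sub_cancel] at hab
  simp only [hab x hx]
  ring_nf

/-- The function `f` on `(-∞, c]`, replaced by the line `1 - x + δ` beyond `c`. -/
noncomputable def lowerTail (f : ℝ → ℝ) (c δ x : ℝ) : ℝ := if x ≤ c then f x else 1 - x + δ

theorem lowerTail_of_le {f : ℝ → ℝ} {c δ x : ℝ} (h : x ≤ c) : lowerTail f c δ x = f x :=
  if_pos h

theorem lowerTail_of_lt {f : ℝ → ℝ} {c δ x : ℝ} (h : c < x) : lowerTail f c δ x = 1 - x + δ :=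
  if_neg h.not_ge

theorem IsPWith.lowerTail {f : ℝ → ℝ} {m : ℕ} {ρ : ℕ → ℚ} (hf : IsPWith f m ρ) {c : ℚ} {δ : ℝ}
    (hρc : ρ m < c) (hc : c < 1) (hδ : 0 < δ) (hcδ : 1 - c + δ ≤ f 1) :
    IsPWith (lowerTail f c δ) (m + 1)
      (fun i => if i ≤ m then ρ i else if i = m + 1 then c else 1) := by
  obtain ⟨hmem, hanti, h0, h1, hlt, haff, ⟨ε, hε, hone⟩, hpos, hlim⟩ := hf
  have hρ0 : 0 ≤ ρ m := by
    rcases Nat.eq_zero_or_pos m with rfl | hm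
    · exact h0.ge
    · exact h0 ▸ (hlt 0 m hm (by omega)).le
  have hc0 : (0 : ℝ) < c := by exact_mod_cast hρ0.trans_lt hρc
  have hc1 : (c : ℝ) < 1 := by exact_mod_cast hc
  have hf1 := (hmem 1 (by simp)).2
  refine ⟨fun x hx => ?_, fun x y hx hxy hy => ?_, by simp [h0], by simp, fun i j hij hj => ?_,
    fun i hi him => ?_, ⟨min ε c, lt_min hε hc0, fun x hx hxε => ?_⟩, ?_, fun a ha => ?_⟩
  · rcases le_or_gt x c with h | h
    · rw [lowerTail_of_le h]
      exact hmem x hx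
    · rw [lowerTail_of_lt h]
      constructor <;> linarith [hx.2]
  · rcases le_or_gt y c with h | h
    · rw [lowerTail_of_le h, lowerTail_of_le (hxy.trans h)]
      exact hanti x y hx hxy hy
    · rcases le_or_gt x c with h' | h'
      · rw [lowerTail_of_lt h, lowerTail_of_le h']
        linarith [hanti x 1 hx (by linarith) le_rfl]
      · rw [lowerTail_of_lt h, lowerTail_of_lt h']
        linarith
  · have hle : ∀ k ≤ m, ρ k ≤ ρ m := fun k hk => by
      rcases hk.eq_or_lt with rfl | hk
      · exact le_rfl
      · exact (hlt k m hk (by omega)).le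
    dsimp only
    split_ifs with h₁ h₂ h₃ h₄ h₅ h₆
    · exact hlt i j hij (by omega)
    · exact (hle i h₁).trans_lt hρc
    · exact ((hle i h₁).trans_lt hρc).trans hc
    all_goals omega
  · rcases Nat.lt_or_ge m i with him' | him'
    · rcases eq_or_ne i (m + 1) with rfl | hne
      · obtain ⟨a, b, hab⟩ := haff (m + 1) (by omega) le_rfl
        refine ⟨a, b, fun x hx => ?_⟩
        simp only [Nat.add_sub_cancel, le_refl, if_true, Nat.not_succ_le_self, if_false] at hx
        rw [lowerTail_of_le hx.2.le]
        refine hab x ⟨by simpa using hx.1, ?_⟩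
        rw [h1]
        exact_mod_cast hx.2.trans hc1
      · obtain rfl : i = m + 2 := by omega
        refine ⟨-1, 1 + δ, fun x hx => ?_⟩
        have hx' : (c : ℝ) < x := by simpa using hx.1
        rw [lowerTail_of_lt hx']
        ring
    · obtain ⟨a, b, hab⟩ := haff i hi (by omega)
      refine ⟨a, b, fun x hx => ?_⟩
      simp only [him', if_true, show i - 1 ≤ m by omega] at hx
      have hic : (ρ i : ℝ) < c := by
        rcases him'.eq_or_lt with rfl | h
        · exact_mod_cast hρc
        · exact_mod_cast (hlt i m h (by omega)).trans hρc
      rw [lowerTail_of_le (hx.2.trans hic).le]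
      exact hab x hx
  · rw [lowerTail_of_le (hxε.le.trans (min_le_right _ _))]
    exact hone x hx (hxε.trans_le (min_le_left _ _))
  · rw [lowerTail_of_lt hc1]
    linarith
  · rcases lt_or_ge a c with h | h
    · obtain ⟨L, hL, hLa⟩ := hlim a ha
      refine ⟨L, hL.congr' ?_, hLa⟩
      filter_upwards [Ioo_mem_nhdsGT h] with x hx
      exact (lowerTail_of_le hx.2.le).symm
    · refine ⟨1 - a + δ, ?_, by linarith⟩
      have hcont : Continuous fun x : ℝ => 1 - x + δ := by fun_prop
      refine ((hcont.tendsto a).mono_left nhdsWithin_le_nhds).congr' ?_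
      filter_upwards [self_mem_nhdsWithin] with x hx
      exact (lowerTail_of_lt (h.trans_lt hx)).symm

theorem integral_abs_lowerTail_sub_rpow_le {f : ℝ → ℝ} {c δ p : ℝ} (hp : 0 < p)
    (hf : ∀ x ∈ Icc (0 : ℝ) 1, f x ∈ Icc (0 : ℝ) 1)
    (hg : ∀ x ∈ Icc (0 : ℝ) 1, lowerTail f c δ x ∈ Icc (0 : ℝ) 1) (hc0 : 0 ≤ c) (hc1 : c ≤ 1) :
    ∫ x in (0 : ℝ)..1, |lowerTail f c δ x - f x| ^ p ≤ 1 - c := by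
  rw [intervalIntegral.integral_of_le zero_le_one]
  have hint : IntegrableOn ((Ioc c 1).indicator fun _ => (1 : ℝ)) (Ioc 0 1) :=
    (integrable_const (1 : ℝ)).indicator measurableSet_Ioc
  calc ∫ x in Ioc (0 : ℝ) 1, |lowerTail f c δ x - f x| ^ p
      ≤ ∫ x in Ioc (0 : ℝ) 1, (Ioc c 1).indicator (fun _ => (1 : ℝ)) x := by
        refine integral_mono_of_nonneg (ae_of_all _ fun x => by positivity) hint ?_
        filter_upwards [ae_restrict_mem measurableSet_Ioc] with x hx
        rcases le_or_gt x c with h | h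
        · simp [lowerTail_of_le h, hp.ne', h.not_gt]
        · rw [indicator_of_mem (show x ∈ Ioc c 1 from ⟨h, hx.2⟩)]
          have hx' : x ∈ Icc (0 : ℝ) 1 := ⟨hx.1.le, hx.2⟩
          refine Real.rpow_le_one (abs_nonneg _) (abs_le.2 ?_) hp.le
          constructor <;> linarith [(hf x hx').1, (hf x hx').2, (hg x hx').1, (hg x hx').2]
    _ = 1 - c := by
        rw [setIntegral_indicator measurableSet_Ioc,
          inter_eq_right.2 (Ioc_subset_Ioc_left hc0)]
        simp [hc1]

theorem integral_log_lowerTail_le {f : ℝ → ℝ} {c δ : ℝ}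
    (hf : ∀ x ∈ Icc (0 : ℝ) 1, f x ∈ Icc (0 : ℝ) 1) (hc0 : 0 ≤ c) (hc1 : c ≤ 1)
    (hint : IntervalIntegrable (fun x => Real.log (lowerTail f c δ x + x - 1)) volume 0 1) :
    ∫ x in (0 : ℝ)..1, Real.log (lowerTail f c δ x + x - 1) ≤ (1 - c) * Real.log δ := by
  have hcmem : c ∈ uIcc (0 : ℝ) 1 := by rw [uIcc_of_le zero_le_one]; exact ⟨hc0, hc1⟩
  have h₁ := hint.mono_set (uIcc_subset_uIcc_left hcmem)
  have h₂ := hint.mono_set (uIcc_subset_uIcc_right hcmem)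
  rw [← intervalIntegral.integral_add_adjacent_intervals h₁ h₂]
  have hleft : ∫ x in (0 : ℝ)..c, Real.log (lowerTail f c δ x + x - 1) ≤ 0 := by
    rw [intervalIntegral.integral_of_le hc0]
    refine setIntegral_nonpos measurableSet_Ioc fun x hx => ?_
    have hfx := hf x ⟨hx.1.le, hx.2.trans hc1⟩
    rw [lowerTail_of_le hx.2, ← Real.log_abs]
    refine Real.log_nonpos (abs_nonneg _) (abs_le.2 ?_)
    constructor <;> linarith [hx.1, hx.2, hfx.1, hfx.2]
  have hright : ∫ x in c..1, Real.log (lowerTail f c δ x + x - 1) = (1 - c) * Real.log δ := by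
    rw [intervalIntegral.integral_of_le hc1,
      setIntegral_congr_fun (g := fun _ => Real.log δ) measurableSet_Ioc fun x hx => ?_]
    · simp [hc1]
    · simp only [lowerTail_of_lt hx.1]
      ring_nf
  linarith

theorem tendsto_integral_nhdsGT_zero {h : ℝ → ℝ} (hint : IntervalIntegrable h volume 0 1) :
    Tendsto (fun ε : ℝ => ∫ x in ε..1, h x) (nhdsWithin 0 (Ioi 0))
      (nhds (∫ x in (0 : ℝ)..1, h x)) := by
  have hcont := intervalIntegral.continuousOn_primitive_interval_left (f := h) (μ := volume)
    (a := 0) (b := 1) (by simpa [intervalIntegrable_iff_integrableOn_Icc_of_le] using hint)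
  refine (hcont 0 (by simp)).mono_left (nhdsWithin_le_of_mem ?_)
  rw [uIcc_of_le zero_le_one]
  exact mem_of_superset (Ioo_mem_nhdsGT zero_lt_one) Ioo_subset_Icc_self

/-- fix `p ≥ 1`. For every `f ∈ 𝒫` there is a sequence `g_n ∈ 𝒫`
with `∫_0^1 |g_n - f|^p → 0`, while `B_{g_n} → -∞` (the numbers `B_{g_n}` being
defined as the limits `lim_{ε↘0} ∫_ε^1 log(g_n(x)+x-1) dx`). In particular,
`f ↦ B_f` is discontinuous at every point of `(𝒫, L^p)`. -/
theorem stmt5 (p : ℝ) (hp : 1 ≤ p) (f : ℝ → ℝ) (hf : IsP f) :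
    ∃ (g : ℕ → ℝ → ℝ) (B : ℕ → ℝ),
      (∀ n : ℕ, IsP (g n)) ∧
      Filter.Tendsto (fun n : ℕ => ∫ x in (0:ℝ)..1, |g n x - f x| ^ p)
        Filter.atTop (nhds 0) ∧
      (∀ n : ℕ, Filter.Tendsto (fun ε : ℝ => ∫ x in ε..1, Real.log (g n x + x - 1))
        (nhdsWithin 0 (Set.Ioi 0)) (nhds (B n))) ∧
      Filter.Tendsto B Filter.atTop Filter.atBot := by
  obtain ⟨m, ρ, hf⟩ := hf
  have hfpos : 0 < f 1 := hf.2.2.2.2.2.2.2.1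
  have hρ1 : ρ m < 1 := hf.2.2.2.1 ▸ hf.2.2.2.2.1 m (m + 1) (by omega) le_rfl
  have hρ1' : (0 : ℝ) < 1 - ρ m := by
    have : (ρ m : ℝ) < 1 := by exact_mod_cast hρ1
    linarith
  obtain ⟨N, hN⟩ := exists_nat_one_div_lt (lt_min (half_pos hfpos) hρ1')
  have hNf := hN.trans_le (min_le_left _ _)
  have hNρ := hN.trans_le (min_le_right _ _)
  let k : ℕ → ℕ := fun n => n + N + 1
  let c : ℕ → ℚ := fun n => 1 - 1 / k n
  let δ : ℕ → ℝ := fun n => Real.exp (-(k n : ℝ) ^ 2)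
  have hk1 (n) : (1 : ℝ) ≤ k n := by exact_mod_cast Nat.le_add_left 1 (n + N)
  have hkN (n) : 1 / (k n : ℝ) ≤ 1 / ((N : ℝ) + 1) := by
    refine one_div_le_one_div_of_le (by positivity) ?_
    exact_mod_cast (show N + 1 ≤ n + N + 1 by omega)
  have hcη (n) : (1 : ℝ) - c n = 1 / k n := by simp [c]
  have hη0 (n) : 0 < 1 / (k n : ℝ) := one_div_pos.2 (by linarith [hk1 n])
  have hη1 (n) : 1 / (k n : ℝ) ≤ 1 := (div_le_one (by linarith [hk1 n])).2 (hk1 n)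
  have hδ (n) : δ n ≤ 1 / k n := by
    rw [one_div]
    simp only [δ, Real.exp_neg]
    refine inv_anti₀ (by linarith [hk1 n]) ?_
    nlinarith [Real.add_one_le_exp ((k n : ℝ) ^ 2), hk1 n]
  have hkt : Tendsto (fun n => (k n : ℝ)) atTop atTop :=
    tendsto_natCast_atTop_atTop.comp (tendsto_atTop_mono (fun n => by simp only [k, id]; omega)
      tendsto_id)
  have hg (n) := hf.lowerTail (c := c n) (δ := δ n)
    (by have : (ρ m : ℝ) < c n := by linarith [hcη n, hkN n]
        exact_mod_cast this)
    (by have : (c n : ℝ) < 1 := by linarith [hcη n, hη0 n]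
        exact_mod_cast this)
    (Real.exp_pos _) (by linarith [hcη n, hkN n, hδ n])
  refine ⟨fun n => lowerTail f (c n) (δ n),
    fun n => ∫ x in (0 : ℝ)..1, Real.log (lowerTail f (c n) (δ n) x + x - 1),
    fun n => ⟨_, _, hg n⟩, ?_, fun n => tendsto_integral_nhdsGT_zero (hg n).intervalIntegrable_log,
    ?_⟩
  · refine squeeze_zero (g := fun n => 1 / (k n : ℝ))
      (fun n => intervalIntegral.integral_nonneg zero_le_one fun x _ => by positivity)
      (fun n => ?_) (hkt.const_div_atTop 1)
    rw [← hcη]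
    exact integral_abs_lowerTail_sub_rpow_le (by linarith) hf.1 (hg n).1
      (by linarith [hcη n, hη1 n]) (by linarith [hcη n, hη0 n])
  · refine tendsto_atBot_mono (fun n => ?_) (tendsto_neg_atTop_atBot.comp hkt)
    refine (integral_log_lowerTail_le hf.1 (by linarith [hcη n, hη1 n])
      (by linarith [hcη n, hη0 n]) (hg n).intervalIntegrable_log).trans_eq ?_
    have hk0 : (k n : ℝ) ≠ 0 := by linarith [hk1 n]
    simp only [hcη, δ, Real.log_exp, Function.comp_apply]
    field_simp
end

section
/- For every positive integer k, the cardinality of the class 𝒫̃_k (as a set of functions from [0,1] to [0,1]) equals (1/k)·C(3k−2, k−1), where C(·,·) denotes the binomial coefficient. -/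
open Filter Set

/-- `f` belongs to the class `𝒫̃_k` : `f ∈ 𝒫`, `k·f(i/k) ∈ ℤ` for `i ∈ {1,…,k}`,
`f` is upper semicontinuous on `[0,1]`, and on each `((i-1)/k, i/k)` the function
`f` is affine with non-positive integer slope. -/
def IsPtilde (k : ℕ) (f : ℝ → ℝ) : Prop :=
  IsP f ∧
  (∀ i : ℕ, 1 ≤ i → i ≤ k → ∃ z : ℤ, (k : ℝ) * f ((i : ℝ) / (k : ℝ)) = (z : ℝ)) ∧
  UpperSemicontinuousOn f (Set.Icc (0:ℝ) 1) ∧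
  (∀ i : ℕ, 1 ≤ i → i ≤ k → ∃ (s : ℤ) (b : ℝ), s ≤ 0 ∧
    ∀ x ∈ Set.Ioo (((i : ℝ) - 1) / (k : ℝ)) ((i : ℝ) / (k : ℝ)),
      f x = (s : ℝ) * x + b)

/-- Weakly increasing sequences `w 0 ≤ ⋯ ≤ w x ≤ y` of naturals with `w j ≤ j / 2`, extended by
zero beyond index `x`. -/
def halfBoundedSeq (x y : ℕ) : Set (ℕ → ℕ) :=
  {w | (∀ j < x, w j ≤ w (j + 1)) ∧ (∀ j ≤ x, 2 * w j ≤ j) ∧ w x ≤ y ∧ ∀ j > x, w j = 0}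

theorem halfBoundedSeq_mono {x y : ℕ} {w : ℕ → ℕ} (hw : w ∈ halfBoundedSeq x y) {i j : ℕ}
    (hij : i ≤ j) (hj : j ≤ x) : w i ≤ w j := by
  induction j, hij using Nat.le_induction with
  | base => exact le_rfl
  | succ j hij ih => exact (ih (by omega)).trans (hw.1 j (by omega))

theorem halfBoundedSeq_eq_singleton {x y : ℕ} (h : x = 0 ∨ y = 0) :
    halfBoundedSeq x y = {fun _ => 0} := by
  ext w
  simp only [mem_singleton_iff]
  constructor
  · intro hw
    funext j
    rcases le_or_gt j x with hj | hj
    · have h1 := halfBoundedSeq_mono hw hj le_rfl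
      have h2 := hw.2.2.1
      have h3 := hw.2.1 x le_rfl
      omega
    · exact hw.2.2.2 j hj
  · rintro rfl
    simp [halfBoundedSeq]

theorem halfBoundedSeq_succ_of_lt {x y : ℕ} (h : x < 2 * (y + 1)) :
    halfBoundedSeq x (y + 1) = halfBoundedSeq x y := by
  ext w
  constructor
  · rintro ⟨h1, h2, h3, h4⟩
    have := h2 x le_rfl
    exact ⟨h1, h2, by omega, h4⟩
  · rintro ⟨h1, h2, h3, h4⟩
    exact ⟨h1, h2, by omega, h4⟩

theorem halfBoundedSeq_succ_succ {x y : ℕ} (h : 2 * (y + 1) ≤ x + 1) :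
    halfBoundedSeq (x + 1) (y + 1) = halfBoundedSeq (x + 1) y ∪
      (fun w => Function.update w (x + 1) (y + 1)) '' halfBoundedSeq x (y + 1) := by
  ext w
  constructor
  · intro hw
    by_cases hx : w (x + 1) ≤ y
    · exact Or.inl ⟨hw.1, hw.2.1, hx, hw.2.2.2⟩
    · have hx' : w (x + 1) = y + 1 := by have := hw.2.2.1; omega
      refine Or.inr ⟨Function.update w (x + 1) 0, ⟨?_, ?_, ?_, ?_⟩, ?_⟩
      · intro j hj
        rw [Function.update_of_ne (by omega), Function.update_of_ne (by omega)]
        exact hw.1 j (by omega)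
      · intro j hj
        rw [Function.update_of_ne (by omega)]
        exact hw.2.1 j (by omega)
      · rw [Function.update_of_ne (by omega), ← hx']
        exact hw.1 x (by omega)
      · intro j hj
        by_cases hj' : j = x + 1
        · simp [hj']
        · rw [Function.update_of_ne hj']
          exact hw.2.2.2 j (by omega)
      · simp [← hx']
  · rintro (hw | ⟨v, hv, rfl⟩)
    · exact ⟨hw.1, hw.2.1, hw.2.2.1.trans (by omega), hw.2.2.2⟩
    · refine ⟨?_, ?_, ?_, ?_⟩
      · intro j hj
        dsimp only
        rw [Function.update_of_ne (by omega)]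
        by_cases hj' : j = x
        · subst hj'
          simpa using hv.2.2.1
        · rw [Function.update_of_ne (by omega)]
          exact hv.1 j (by omega)
      · intro j hj
        dsimp only
        by_cases hj' : j = x + 1
        · subst hj'
          simpa using h
        · rw [Function.update_of_ne hj']
          exact hv.2.1 j (by omega)
      · simp
      · intro j hj
        dsimp only
        rw [Function.update_of_ne (by omega)]
        exact hv.2.2.2 j (by omega)

theorem injOn_update_halfBoundedSeq (x y : ℕ) :
    InjOn (fun w : ℕ → ℕ => Function.update w (x + 1) (y + 1)) (halfBoundedSeq x (y + 1)) := by
  intro v hv w hw h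
  funext j
  by_cases hj : j = x + 1
  · rw [hv.2.2.2 j (by omega), hw.2.2.2 j (by omega)]
  · simpa [hj] using congrFun h j

/-- The ballot-type count of `halfBoundedSeq x y`. -/
theorem finite_and_ncard_halfBoundedSeq (x y : ℕ) (h : 2 * y ≤ x + 1) :
    (halfBoundedSeq x y).Finite ∧
      ((x : ℚ) + 2) * (halfBoundedSeq x y).ncard = (x + 2 - 2 * y) * (x + 1 + y).choose y := by
  induction x generalizing y with
  | zero =>
    obtain rfl : y = 0 := by omega
    rw [halfBoundedSeq_eq_singleton (Or.inl rfl)]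
    simp
  | succ x ihx =>
    induction y with
    | zero =>
      rw [halfBoundedSeq_eq_singleton (Or.inr rfl)]
      simp
    | succ y ihy =>
      obtain ⟨fin₁, card₁⟩ := ihy (by omega)
      have hchoose : ((x + y + 2).choose (y + 1) : ℚ) * (y + 1) =
          (x + y + 2).choose y * (x + 2) := by
        have := Nat.choose_succ_right_eq (x + y + 2) y
        rw [show x + y + 2 - y = x + 2 by omega] at this
        exact_mod_cast this
      have hpascal : ((x + y + 3).choose (y + 1) : ℚ) =
          (x + y + 2).choose y + (x + y + 2).choose (y + 1) := by
        exact_mod_cast Nat.choose_succ_succ (x + y + 2) y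
      rw [show x + 1 + 1 + y = x + y + 2 by omega] at card₁
      rw [show x + 1 + 1 + (y + 1) = x + y + 3 by omega, hpascal]
      push_cast at card₁ ⊢
      rcases Nat.lt_or_ge (x + 1) (2 * (y + 1)) with hlt | hle
      · rw [halfBoundedSeq_succ_of_lt hlt]
        refine ⟨fin₁, card₁.trans ?_⟩
        have hx : (x : ℚ) = 2 * y := by
          have : x = 2 * y := by omega
          exact_mod_cast this
        rw [hx] at hchoose ⊢
        apply mul_left_cancel₀ (by positivity : (y : ℚ) + 1 ≠ 0)
        linear_combination -hchoose
      · obtain ⟨fin₂, card₂⟩ := ihx (y + 1) hle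
        rw [show x + 1 + (y + 1) = x + y + 2 by omega] at card₂
        have hdisj : Disjoint (halfBoundedSeq (x + 1) y)
            ((fun w => Function.update w (x + 1) (y + 1)) '' halfBoundedSeq x (y + 1)) := by
          rw [Set.disjoint_left]
          rintro _ hw ⟨v, -, rfl⟩
          have := hw.2.2.1
          simp at this
        rw [halfBoundedSeq_succ_succ hle, ncard_union_eq hdisj fin₁ (fin₂.image _),
          (injOn_update_halfBoundedSeq x y).ncard_image]
        refine ⟨fin₁.union (fin₂.image _), ?_⟩
        have hx : (x : ℚ) + 2 ≠ 0 := by positivity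
        push_cast at card₂ ⊢
        apply mul_left_cancel₀ hx
        linear_combination (x + 2 : ℚ) * card₁ + (x + 3 : ℚ) * card₂ - 2 * hchoose

theorem succ_mul_ncard_halfBoundedSeq (n : ℕ) :
    (n + 1) * (halfBoundedSeq (2 * n) n).ncard = (3 * n + 1).choose n := by
  have h := (finite_and_ncard_halfBoundedSeq (2 * n) n (by omega)).2
  rw [show 2 * n + 1 + n = 3 * n + 1 by omega] at h
  push_cast at h
  have : ((n : ℚ) + 1) * (halfBoundedSeq (2 * n) n).ncard = (3 * n + 1).choose n := by
    linear_combination h / 2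
  exact_mod_cast this

/-- The affine function on `(j / k, (j + 1) / k]` with right limit `1 - w (2 j - 1) / k` at the left
end and value `1 - w (2 j) / k` at the right end. -/
noncomputable def affinePiece (k : ℕ) (w : ℕ → ℕ) (j : ℕ) (x : ℝ) : ℝ :=
  (k - w (2 * j - 1) - ((w (2 * j) : ℝ) - w (2 * j - 1)) * (k * x - j)) / k

/-- The left-continuous function glued from the affine pieces encoded by `w`. -/
noncomputable def functionOfSeq (k : ℕ) (w : ℕ → ℕ) (x : ℝ) : ℝ :=
  affinePiece k w (⌈(k : ℝ) * x⌉₊ - 1) x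

theorem functionOfSeq_eq {k : ℕ} {w : ℕ → ℕ} {j : ℕ} {x : ℝ} (h₁ : (j : ℝ) < k * x)
    (h₂ : (k : ℝ) * x ≤ j + 1) : functionOfSeq k w x = affinePiece k w j x := by
  have : ⌈(k : ℝ) * x⌉₊ = j + 1 := by
    rw [Nat.ceil_eq_iff (by omega)]
    simpa using ⟨h₁, h₂⟩
  rw [functionOfSeq, this, Nat.add_sub_cancel]

theorem functionOfSeq_zero (k : ℕ) (w : ℕ → ℕ) : functionOfSeq k w 0 = affinePiece k w 0 0 := by
  simp [functionOfSeq]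

theorem continuous_affinePiece (k : ℕ) (w : ℕ → ℕ) (j : ℕ) : Continuous (affinePiece k w j) := by
  unfold affinePiece
  fun_prop

theorem exists_nat_lt_mul_le {k : ℕ} (hk : 0 < k) {x : ℝ} (h₀ : 0 < x) (h₁ : x ≤ 1) :
    ∃ j < k, (j : ℝ) < k * x ∧ (k : ℝ) * x ≤ j + 1 := by
  have hk' : (0 : ℝ) < k := by exact_mod_cast hk
  have hpos : 0 < ⌈(k : ℝ) * x⌉₊ := Nat.ceil_pos.2 (by positivity)
  obtain ⟨j, hj⟩ := Nat.exists_eq_succ_of_ne_zero hpos.ne'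
  rw [Nat.succ_eq_add_one, Nat.ceil_eq_iff (by omega)] at hj
  simp only [Nat.add_sub_cancel, Nat.cast_add, Nat.cast_one] at hj
  refine ⟨j, ?_, hj⟩
  have : (j : ℝ) < k := by nlinarith
  exact_mod_cast this

section

variable {k : ℕ} {w : ℕ → ℕ}

theorem apply_two_mul_sub_one_le {n j : ℕ} (hw : w ∈ halfBoundedSeq (2 * n) n) (hj : j ≤ n) :
    w (2 * j - 1) ≤ w (2 * j) :=
  halfBoundedSeq_mono hw (by omega) (by omega)

theorem mul_affinePiece (hk : 0 < k) (j : ℕ) (x : ℝ) : (k : ℝ) * affinePiece k w j x =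
    k - w (2 * j - 1) - ((w (2 * j) : ℝ) - w (2 * j - 1)) * (k * x - j) := by
  have hk' : (k : ℝ) ≠ 0 := by exact_mod_cast hk.ne'
  rw [affinePiece]
  field_simp

theorem affinePiece_antitone {j : ℕ} (h : w (2 * j - 1) ≤ w (2 * j)) :
    Antitone (affinePiece k w j) := by
  intro x y hxy
  have h' : (w (2 * j - 1) : ℝ) ≤ w (2 * j) := by exact_mod_cast h
  unfold affinePiece
  have : (0 : ℝ) ≤ (w (2 * j) : ℝ) - w (2 * j - 1) := by linarith
  gcongr

theorem functionOfSeq_antitone (hk : 0 < k) (hw : w ∈ halfBoundedSeq (2 * (k - 1)) (k - 1))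
    {x y : ℝ} (hx : 0 ≤ x) (hxy : x ≤ y) (hy : y ≤ 1) :
    functionOfSeq k w y ≤ functionOfSeq k w x := by
  have hk' : (0 : ℝ) < k := by exact_mod_cast hk
  have key : ∀ x : ℝ, 0 ≤ x → x ≤ 1 → ∃ j < k, (j : ℝ) ≤ k * x ∧ k * x ≤ j + 1 ∧
      functionOfSeq k w x = affinePiece k w j x ∧ (∀ i : ℕ, (k : ℝ) * x ≤ i + 1 → j ≤ i) := by
    intro x h₀ h₁
    rcases h₀.eq_or_lt with rfl | h₀
    · exact ⟨0, hk, by simp, by simp, functionOfSeq_zero k w, by simp⟩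
    · obtain ⟨j, hj, h, h'⟩ := exists_nat_lt_mul_le hk h₀ h₁
      refine ⟨j, hj, h.le, h', functionOfSeq_eq h h', fun i hi => ?_⟩
      have : (j : ℝ) < i + 1 := by linarith
      have : j < i + 1 := by exact_mod_cast this
      omega
  obtain ⟨i, hi, hi₁, hi₂, hix, himin⟩ := key x hx (hxy.trans hy)
  obtain ⟨j, hj, hj₁, hj₂, hjy, hjmin⟩ := key y (hx.trans hxy) hy
  rw [hix, hjy]
  have hkxy : (k : ℝ) * x ≤ k * y := by gcongr
  have hij : i ≤ j := himin j (hkxy.trans hj₂)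
  rcases hij.eq_or_lt with rfl | hij
  · exact affinePiece_antitone (apply_two_mul_sub_one_le hw (by omega)) hxy
  · have h₁ : (w (2 * i - 1) : ℝ) ≤ w (2 * i) := by
      exact_mod_cast apply_two_mul_sub_one_le hw (by omega)
    have h₂ : (w (2 * j - 1) : ℝ) ≤ w (2 * j) := by
      exact_mod_cast apply_two_mul_sub_one_le hw (by omega)
    have h₃ : (w (2 * i) : ℝ) ≤ w (2 * j - 1) := by
      exact_mod_cast halfBoundedSeq_mono hw (by omega) (by omega)
    refine le_of_mul_le_mul_left ?_ hk'
    rw [mul_affinePiece hk, mul_affinePiece hk]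
    nlinarith [mul_nonneg (sub_nonneg.2 h₁) (sub_nonneg.2 hi₂),
      mul_nonneg (sub_nonneg.2 h₂) (sub_nonneg.2 hj₁)]

theorem functionOfSeq_natCast_div (hk : 0 < k) (j : ℕ) :
    (k : ℝ) * functionOfSeq k w (((j + 1 : ℕ) : ℝ) / k) = k - w (2 * j) := by
  have hk' : (k : ℝ) ≠ 0 := by exact_mod_cast hk.ne'
  have h : (k : ℝ) * (((j + 1 : ℕ) : ℝ) / k) = j + 1 := by
    push_cast
    field_simp
  rw [functionOfSeq_eq (j := j) (by linarith) h.le, mul_affinePiece hk, h]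
  ring

theorem affinePiece_zero (hk : 0 < k) {n : ℕ} (hw : w ∈ halfBoundedSeq n (k - 1)) (x : ℝ) :
    affinePiece k w 0 x = 1 := by
  have hk' : (k : ℝ) ≠ 0 := by exact_mod_cast hk.ne'
  have h : w 0 = 0 := by have := hw.2.1 0 (by omega); omega
  simp [affinePiece, h, hk']

theorem functionOfSeq_eq_one (hk : 0 < k) {n : ℕ} (hw : w ∈ halfBoundedSeq n (k - 1))
    {x : ℝ} (hx : 0 ≤ x) (hx' : (k : ℝ) * x ≤ 1) : functionOfSeq k w x = 1 := by
  have hk' : (0 : ℝ) < k := by exact_mod_cast hk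
  rcases hx.eq_or_lt with rfl | hx
  · rw [functionOfSeq_zero, affinePiece_zero hk hw]
  · rw [functionOfSeq_eq (j := 0) (by simpa using mul_pos hk' hx) (by simpa using hx'),
      affinePiece_zero hk hw]

theorem functionOfSeq_one_pos (hk : 0 < k) (hw : w ∈ halfBoundedSeq (2 * (k - 1)) (k - 1)) :
    0 < functionOfSeq k w 1 := by
  have hk' : (0 : ℝ) < k := by exact_mod_cast hk
  have h := functionOfSeq_natCast_div (w := w) hk (k - 1)
  rw [Nat.sub_add_cancel hk, div_self hk'.ne'] at h
  have h' : w (2 * (k - 1)) < k := by have := hw.2.2.1; omega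
  have h'' : (w (2 * (k - 1)) : ℝ) < k := by exact_mod_cast h'
  refine pos_of_mul_pos_right (a := (k : ℝ)) ?_ hk'.le
  linarith

theorem exists_tendsto_functionOfSeq (hk : 0 < k)
    (hw : w ∈ halfBoundedSeq (2 * (k - 1)) (k - 1)) {a : ℝ} (ha : a ∈ Ioo (0 : ℝ) 1) :
    ∃ L : ℝ, Tendsto (functionOfSeq k w) (nhdsWithin a (Ioi a)) (nhds L) ∧ 1 - a < L := by
  have hk' : (0 : ℝ) < k := by exact_mod_cast hk
  obtain ⟨ha₀, ha₁⟩ := ha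
  obtain ⟨j, hj⟩ : ∃ j, ⌊(k : ℝ) * a⌋₊ = j := ⟨_, rfl⟩
  rw [Nat.floor_eq_iff (by positivity)] at hj
  obtain ⟨hj₁, hj₂⟩ := hj
  have hjk : j < k := by
    have : (j : ℝ) < k := by nlinarith
    exact_mod_cast this
  refine ⟨affinePiece k w j a, ?_, ?_⟩
  · refine Tendsto.congr' ?_ ((continuous_affinePiece k w j).tendsto a |>.mono_left
      nhdsWithin_le_nhds)
    have hlt : a < ((j : ℝ) + 1) / k := by
      rw [lt_div_iff₀ hk']
      linarith
    filter_upwards [Ioo_mem_nhdsGT hlt] with y hy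
    have h₁ : (k : ℝ) * a < k * y := by gcongr; exact hy.1
    have h₂ := (lt_div_iff₀ hk').1 hy.2
    exact (functionOfSeq_eq (by linarith) (by linarith)).symm
  · refine lt_of_mul_lt_mul_left ?_ hk'.le
    rw [mul_affinePiece hk]
    have h₁ : (w (2 * j) : ℝ) ≤ j := by
      have := hw.2.1 (2 * j) (by omega)
      have : w (2 * j) ≤ j := by omega
      exact_mod_cast this
    rcases Nat.eq_zero_or_pos j with rfl | hpos
    · have h₂ : (w 0 : ℝ) = 0 := by
        have := hw.2.1 0 (by omega)
        have : w 0 = 0 := by omega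
        exact_mod_cast this
      have := mul_pos hk' ha₀
      simp only [mul_zero, zero_tsub, h₂]
      linarith
    · have h₂ : (w (2 * j - 1) : ℝ) + 1 ≤ j := by
        have := hw.2.1 (2 * j - 1) (by omega)
        have : w (2 * j - 1) + 1 ≤ j := by omega
        exact_mod_cast this
      nlinarith [mul_nonneg (sub_nonneg.2 h₁) (sub_nonneg.2 hj₁),
        mul_nonneg (sub_nonneg.2 h₂) (sub_nonneg.2 hj₂.le)]

theorem upperSemicontinuousOn_functionOfSeq (hk : 0 < k)
    (hw : w ∈ halfBoundedSeq (2 * (k - 1)) (k - 1)) :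
    UpperSemicontinuousOn (functionOfSeq k w) (Icc (0 : ℝ) 1) := by
  have hk' : (0 : ℝ) < k := by exact_mod_cast hk
  intro x hx b hb
  rcases hx.1.eq_or_lt with rfl | hx₀
  · filter_upwards [self_mem_nhdsWithin] with y hy
    exact (functionOfSeq_antitone hk hw le_rfl hy.1 hy.2).trans_lt hb
  · obtain ⟨j, hj, h₁, h₂⟩ := exists_nat_lt_mul_le hk hx₀ hx.2
    rw [functionOfSeq_eq h₁ h₂] at hb
    have hev₁ : ∀ᶠ y in nhds x, affinePiece k w j y < b :=
      (continuous_affinePiece k w j).tendsto x |>.eventually_lt_const hb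
    have hev₂ : ∀ᶠ y in nhds x, (j : ℝ) < k * y :=
      (continuous_const.mul continuous_id).tendsto x |>.eventually_const_lt h₁
    filter_upwards [self_mem_nhdsWithin, nhdsWithin_le_nhds hev₁, nhdsWithin_le_nhds hev₂]
      with y hy hy₁ hy₂
    rcases le_or_gt x y with hxy | hxy
    · refine (functionOfSeq_antitone hk hw hx.1 hxy hy.2).trans_lt ?_
      rwa [functionOfSeq_eq h₁ h₂]
    · have : (k : ℝ) * y ≤ k * x := by gcongr
      rwa [functionOfSeq_eq hy₂ (by linarith)]

theorem functionOfSeq_affine (hk : 0 < k) {j : ℕ} {x : ℝ}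
    (hx : x ∈ Ioo ((j : ℝ) / k) (((j : ℝ) + 1) / k)) :
    functionOfSeq k w x = ((w (2 * j - 1) : ℤ) - (w (2 * j) : ℤ) : ℤ) * x +
      (k - w (2 * j - 1) + ((w (2 * j) : ℝ) - w (2 * j - 1)) * j) / k := by
  have hk' : (0 : ℝ) < k := by exact_mod_cast hk
  have h₁ := (div_lt_iff₀ hk').1 hx.1
  have h₂ := (lt_div_iff₀ hk').1 hx.2
  rw [functionOfSeq_eq (j := j) (by linarith) (by linarith), affinePiece]
  push_cast
  field_simp
  ring

theorem isPtilde_functionOfSeq (hk : 0 < k) (hw : w ∈ halfBoundedSeq (2 * (k - 1)) (k - 1)) :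
    IsPtilde k (functionOfSeq k w) := by
  have hk' : (0 : ℝ) < k := by exact_mod_cast hk
  have hkq : (0 : ℚ) < k := by exact_mod_cast hk
  have hanti := fun x y => functionOfSeq_antitone (x := x) (y := y) hk hw
  have hpos := functionOfSeq_one_pos hk hw
  refine ⟨⟨k - 1, fun i => (i : ℚ) / k, ?_, hanti, by simp, ?_, ?_, ?_, ?_, hpos,
    fun a ha => exists_tendsto_functionOfSeq hk hw ha⟩, ?_,
    upperSemicontinuousOn_functionOfSeq hk hw, ?_⟩
  · intro x hx
    refine ⟨hpos.le.trans (hanti x 1 hx.1 hx.2 le_rfl), ?_⟩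
    exact (hanti 0 x le_rfl hx.1 hx.2).trans_eq (functionOfSeq_eq_one hk hw le_rfl (by simp))
  · simpa only [Nat.sub_add_cancel hk] using div_self hkq.ne'
  · intro i j hij _
    dsimp only
    gcongr
  · intro i hi _
    obtain ⟨j, rfl⟩ := Nat.exists_eq_add_of_le' hi
    refine ⟨_, _, fun x hx => functionOfSeq_affine (j := j) hk ?_⟩
    simpa using hx
  · refine ⟨1 / k, by positivity, fun x hx hx' => functionOfSeq_eq_one hk hw hx ?_⟩
    have := (lt_div_iff₀ hk').1 hx'
    linarith
  · intro i hi _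
    obtain ⟨j, rfl⟩ := Nat.exists_eq_add_of_le' hi
    refine ⟨(k : ℤ) - w (2 * j), ?_⟩
    rw [functionOfSeq_natCast_div hk]
    push_cast
    rfl
  · intro i hi hik
    obtain ⟨j, rfl⟩ := Nat.exists_eq_add_of_le' hi
    refine ⟨(w (2 * j - 1) : ℤ) - (w (2 * j) : ℤ), _, ?_,
      fun x hx => functionOfSeq_affine (j := j) hk ?_⟩
    · have := apply_two_mul_sub_one_le (j := j) hw (by omega)
      omega
    · simpa using hx

theorem injOn_domRestrict_functionOfSeq (hk : 0 < k) :
    InjOn (fun w => (Icc (0 : ℝ) 1).domRestrict (functionOfSeq k w))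
      (halfBoundedSeq (2 * (k - 1)) (k - 1)) := by
  have hk' : (0 : ℝ) < k := by exact_mod_cast hk
  intro v hv w hw h
  have heq : ∀ x ∈ Icc (0 : ℝ) 1, functionOfSeq k v x = functionOfSeq k w x :=
    fun x hx => congrFun h ⟨x, hx⟩
  have heven : ∀ j < k, (v (2 * j) : ℝ) = w (2 * j) := by
    intro j hj
    have hjk : ((j + 1 : ℕ) : ℝ) ≤ k := by exact_mod_cast hj
    have hx := heq (((j + 1 : ℕ) : ℝ) / k) ⟨by positivity, (div_le_one hk').2 hjk⟩
    have h₁ := functionOfSeq_natCast_div (w := v) hk j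
    have h₂ := functionOfSeq_natCast_div (w := w) hk j
    rw [hx] at h₁
    linarith
  have hodd : ∀ j < k, (v (2 * j - 1) : ℝ) = w (2 * j - 1) := by
    intro j hj
    have hjk : (j : ℝ) + 1 ≤ k := by exact_mod_cast hj
    have hmid : (k : ℝ) * ((j + 1 / 2) / k) = j + 1 / 2 := by field_simp
    have hx := heq (((j : ℝ) + 1 / 2) / k) ⟨by positivity, (div_le_one hk').2 (by linarith)⟩
    rw [functionOfSeq_eq (j := j) (by linarith) (by linarith),
      functionOfSeq_eq (j := j) (by linarith) (by linarith)] at hx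
    have hx' := congrArg (fun t => (k : ℝ) * t) hx
    simp only [mul_affinePiece hk, hmid] at hx'
    linarith [heven j hj]
  funext m
  rcases le_or_gt m (2 * (k - 1)) with hm | hm
  · rcases Nat.even_or_odd' m with ⟨j, rfl | rfl⟩
    · exact_mod_cast heven j (by omega)
    · have := hodd (j + 1) (by omega)
      rw [show 2 * (j + 1) - 1 = 2 * j + 1 by omega] at this
      exact_mod_cast this
  · rw [hv.2.2.2 m hm, hw.2.2.2 m hm]

theorem exists_halfBoundedSeq_eq {n : ℕ} {E D : ℕ → ℤ} (h₀ : E 0 = 0) (h₀' : D 0 = 0)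
    (hED : ∀ j ≤ n, E j ≤ D j) (hDE : ∀ j < n, D j ≤ E (j + 1))
    (hE : ∀ j, 0 < j → j ≤ n → E j < j) (hD : D n ≤ n) :
    ∃ w ∈ halfBoundedSeq (2 * n) n, ∀ j ≤ n, (w (2 * j) : ℤ) = D j ∧ (w (2 * j - 1) : ℤ) = E j := by
  have hnonneg : ∀ j ≤ n, 0 ≤ E j := by
    intro j
    induction j with
    | zero => intro _; exact h₀.ge
    | succ j ih =>
      intro hj
      exact (ih (by omega)).trans ((hED j (by omega)).trans (hDE j (by omega)))
  have hnonneg' : ∀ j ≤ n, 0 ≤ D j := fun j hj => (hnonneg j hj).trans (hED j hj)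
  have hD' : ∀ j ≤ n, D j ≤ j := by
    intro j hj
    rcases hj.eq_or_lt with rfl | hj
    · exact hD
    · have h₁ := hDE j hj
      have h₂ := hE (j + 1) (by omega) hj
      push_cast at h₂
      omega
  obtain ⟨w, hw⟩ : ∃ w : ℕ → ℕ, w = fun m => if m ≤ 2 * n then
      (if m % 2 = 0 then (D (m / 2)).toNat else (E (m / 2 + 1)).toNat) else 0 := ⟨_, rfl⟩
  have hweven : ∀ j ≤ n, (w (2 * j) : ℤ) = D j := by
    intro j hj
    have h₁ : 2 * j / 2 = j := by omega
    simp [hw, hj, h₁, hnonneg' j hj]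
  have hwodd : ∀ j < n, (w (2 * j + 1) : ℤ) = E (j + 1) := by
    intro j hj
    have h₁ : (2 * j + 1) / 2 = j := by omega
    have h₂ : 2 * j + 1 ≤ 2 * n := by omega
    have h₃ : (2 * j + 1) % 2 ≠ 0 := by omega
    simp only [hw, h₁, h₂, h₃, if_true, if_false]
    exact Int.toNat_of_nonneg (hnonneg _ hj)
  refine ⟨w, ⟨?_, ?_, ?_, ?_⟩, ?_⟩
  · intro m hm
    rcases Nat.even_or_odd' m with ⟨j, rfl | rfl⟩
    · have := hDE j (by omega)
      have := hweven j (by omega)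
      have := hwodd j (by omega)
      omega
    · have := hED (j + 1) (by omega)
      have h₁ := hweven (j + 1) (by omega)
      have := hwodd j (by omega)
      rw [show 2 * (j + 1) = 2 * j + 1 + 1 by ring] at h₁
      omega
  · intro m hm
    rcases Nat.even_or_odd' m with ⟨j, rfl | rfl⟩
    · have := hD' j (by omega)
      have := hweven j (by omega)
      omega
    · have := hE (j + 1) (by omega) (by omega)
      have := hwodd j (by omega)
      push_cast at *
      omega
  · have := hweven n le_rfl
    omega
  · intro m hm
    simp [hw, not_le.2 hm]
  · intro j hj
    refine ⟨hweven j hj, ?_⟩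
    rcases Nat.eq_zero_or_pos j with rfl | hpos
    · have := hweven 0 (by omega)
      simp only [mul_zero, zero_tsub] at this ⊢
      omega
    · obtain ⟨i, rfl⟩ := Nat.exists_eq_add_of_le' hpos
      exact hwodd i (by omega)

theorem tendsto_mul_add_const (s b a : ℝ) (S : Set ℝ) :
    Tendsto (fun x => s * x + b) (nhdsWithin a S) (nhds (s * a + b)) :=
  Tendsto.mono_left (Continuous.tendsto (by fun_prop) a) nhdsWithin_le_nhds

theorem eq_of_upperSemicontinuousOn_of_antitone {f : ℝ → ℝ} {c d s b : ℝ} (hc : 0 ≤ c)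
    (hd : d ≤ 1) (hcd : c < d) (hs : s ≤ 0)
    (hanti : ∀ x y : ℝ, 0 ≤ x → x ≤ y → y ≤ 1 → f y ≤ f x)
    (husc : UpperSemicontinuousOn f (Icc (0 : ℝ) 1))
    (hf : ∀ x ∈ Ioo c d, f x = s * x + b) : f d = s * d + b := by
  apply le_antisymm
  · refine ge_of_tendsto (tendsto_mul_add_const s b d (Iio d)) ?_
    filter_upwards [Ioo_mem_nhdsLT hcd] with x hx
    rw [← hf x hx]
    exact hanti x d (hc.trans hx.1.le) hx.2.le hd
  · by_contra! hlt
    have hev := husc d ⟨hc.trans hcd.le, hd⟩ _ hlt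
    have hsub : Ioo c d ⊆ Icc (0 : ℝ) 1 :=
      fun x hx => ⟨hc.trans hx.1.le, hx.2.le.trans hd⟩
    have hev' : ∀ᶠ x in nhdsWithin d (Iio d), f x < s * d + b := by
      rw [← nhdsWithin_Ioo_eq_nhdsLT hcd]
      exact nhdsWithin_mono d hsub hev
    obtain ⟨x, hx, hx'⟩ := (hev'.and (Ioo_mem_nhdsLT hcd)).exists
    rw [hf x hx'] at hx
    nlinarith [hx'.2]

theorem exists_functionOfSeq_eq (hk : 0 < k) {f : ℝ → ℝ} (hf : IsPtilde k f) :
    ∃ w ∈ halfBoundedSeq (2 * (k - 1)) (k - 1),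
      ∀ x ∈ Icc (0 : ℝ) 1, functionOfSeq k w x = f x := by
  have hk' : (0 : ℝ) < k := by exact_mod_cast hk
  obtain ⟨⟨m, ρ, -, hanti, -, -, -, -, ⟨ε, hε, hone⟩, hpos, hlim⟩, hint, husc, hslope⟩ := hf
  have hpiece : ∀ j : ℕ, ∃ (z s : ℤ) (b : ℝ), j < k → s ≤ 0 ∧
      (k : ℝ) * f (((j : ℝ) + 1) / k) = z ∧
      ∀ x ∈ Ioo ((j : ℝ) / k) (((j : ℝ) + 1) / k), f x = s * x + b := by
    intro j
    by_cases hj : j < k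
    · obtain ⟨z, hz⟩ := hint (j + 1) (by omega) hj
      obtain ⟨s, b, hs, hsb⟩ := hslope (j + 1) (by omega) hj
      push_cast at hz hsb
      rw [add_sub_cancel_right] at hsb
      exact ⟨z, s, b, fun _ => ⟨hs, hz, hsb⟩⟩
    · exact ⟨0, 0, 0, fun h => absurd h hj⟩
  choose z s b hzsb using hpiece
  have hends : ∀ j < k, 0 ≤ (j : ℝ) / k ∧ ((j : ℝ) + 1) / k ≤ 1 ∧
      (j : ℝ) / k < ((j : ℝ) + 1) / k := by
    intro j hj
    have : (j : ℝ) + 1 ≤ k := by exact_mod_cast hj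
    refine ⟨by positivity, (div_le_one hk').2 this, ?_⟩
    gcongr
    linarith
  have hright : ∀ j < k, f (((j : ℝ) + 1) / k) = s j * (((j : ℝ) + 1) / k) + b j := by
    intro j hj
    obtain ⟨h₀, h₁, h₂⟩ := hends j hj
    exact eq_of_upperSemicontinuousOn_of_antitone h₀ h₁ h₂ (by exact_mod_cast (hzsb j hj).1)
      hanti husc (hzsb j hj).2.2
  have hb : ∀ j < k, (k : ℝ) * b j = z j - s j * (j + 1) := by
    intro j hj
    rw [← (hzsb j hj).2.1, hright j hj]
    field_simp
    ring
  have htendsto : ∀ j < k, Tendsto f (nhdsWithin ((j : ℝ) / k) (Ioi ((j : ℝ) / k)))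
      (nhds (s j * ((j : ℝ) / k) + b j)) := by
    intro j hj
    refine Tendsto.congr' ?_ (tendsto_mul_add_const (s j) (b j) _ _)
    filter_upwards [Ioo_mem_nhdsGT (hends j hj).2.2] with x hx
    exact ((hzsb j hj).2.2 x hx).symm
  have hleft : ∀ j < k, (k : ℝ) * (s j * ((j : ℝ) / k) + b j) = z j - s j := by
    intro j hj
    rw [mul_add, hb j hj]
    field_simp
    ring
  have hfirst : s 0 = 0 ∧ z 0 = k := by
    have hδ : 0 < min ε (1 / k) := by positivity
    have hval : ∀ x : ℝ, 0 < x → x < min ε (1 / k) → (s 0 : ℝ) * x + b 0 = 1 := by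
      intro x hx hx'
      rw [← (hzsb 0 hk).2.2 x (by simpa using And.intro hx (lt_min_iff.1 hx').2)]
      exact hone x hx.le (lt_min_iff.1 hx').1
    have h₁ := hval (min ε (1 / k) / 2) (by linarith) (by linarith)
    have h₂ := hval (min ε (1 / k) / 3) (by linarith) (by linarith)
    have hs0 : (s 0 : ℝ) = 0 := by
      have : (s 0 : ℝ) * (min ε (1 / k) / 6) = 0 := by linarith
      rcases mul_eq_zero.1 this with h | h
      · exact h
      · linarith
    have hb0 := hb 0 hk
    rw [hs0] at h₁ hb0
    have hb1 : b 0 = 1 := by linarith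
    rw [hb1] at hb0
    refine ⟨by exact_mod_cast hs0, ?_⟩
    have : (z 0 : ℝ) = k := by linarith
    exact_mod_cast this
  obtain ⟨w, hw, hwED⟩ := exists_halfBoundedSeq_eq (n := k - 1)
    (E := fun j => k - z j + s j) (D := fun j => k - z j)
    (by simp [hfirst]) (by simp [hfirst])
    (fun j hj => by have := (hzsb j (by omega)).1; omega)
    (fun j hj => by
      have hj' : j + 1 < k := by omega
      have hle : s (j + 1) * (((j + 1 : ℕ) : ℝ) / k) + b (j + 1) ≤ f (((j + 1 : ℕ) : ℝ) / k) := by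
        obtain ⟨h₀, h₁, h₂⟩ := hends (j + 1) hj'
        refine le_of_tendsto (htendsto (j + 1) hj') ?_
        filter_upwards [Ioo_mem_nhdsGT h₂] with x hx
        exact hanti _ x h₀ hx.1.le (hx.2.le.trans h₁)
      have hle' := mul_le_mul_of_nonneg_left hle hk'.le
      rw [hleft (j + 1) hj', Nat.cast_succ, (hzsb j (by omega)).2.1] at hle'
      have : z (j + 1) - s (j + 1) ≤ z j := by exact_mod_cast hle'
      omega)
    (fun j hj hjk => by
      have hj' : j < k := by omega
      have hjr : (0 : ℝ) < j := by exact_mod_cast hj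
      have hjkr : (j : ℝ) < k := by exact_mod_cast hj'
      obtain ⟨L, hL, hlt⟩ := hlim ((j : ℝ) / k) ⟨by positivity, (div_lt_one hk').2 hjkr⟩
      rw [tendsto_nhds_unique hL (htendsto j hj')] at hlt
      have hlt' := mul_lt_mul_of_pos_left hlt hk'
      rw [hleft j hj', mul_sub, mul_one, mul_div_cancel₀ _ hk'.ne'] at hlt'
      have : (k : ℤ) - j < z j - s j := by exact_mod_cast hlt'
      omega)
    (by
      have h := (hzsb (k - 1) (by omega)).2.1
      have hcast : ((k - 1 : ℕ) : ℝ) + 1 = k := by exact_mod_cast Nat.sub_add_cancel hk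
      rw [hcast, div_self hk'.ne'] at h
      have hz : (0 : ℝ) < z (k - 1) := by
        rw [← h]
        positivity
      have : 0 < z (k - 1) := by exact_mod_cast hz
      omega)
  refine ⟨w, hw, fun x hx => ?_⟩
  rcases hx.1.eq_or_lt with rfl | hx₀
  · rw [hone 0 le_rfl hε, functionOfSeq_eq_one hk hw le_rfl (by simp)]
  · obtain ⟨j, hj, h₁, h₂⟩ := exists_nat_lt_mul_le hk hx₀ hx.2
    have hfx : f x = s j * x + b j := by
      rcases h₂.eq_or_lt with h₂ | h₂
      · rw [show x = ((j : ℝ) + 1) / k by rw [← h₂]; field_simp, hright j hj]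
      · refine (hzsb j hj).2.2 x ⟨(div_lt_iff₀ hk').2 (by linarith), (lt_div_iff₀ hk').2 ?_⟩
        linarith
    obtain ⟨hD, hE⟩ := hwED j (by omega)
    have hD' : (w (2 * j) : ℝ) = k - z j := by exact_mod_cast hD
    have hE' : (w (2 * j - 1) : ℝ) = k - z j + s j := by exact_mod_cast hE
    apply mul_left_cancel₀ hk'.ne'
    rw [functionOfSeq_eq h₁ h₂, mul_affinePiece hk, hD', hE', hfx, mul_add, hb j hj]
    ring

end

/-- for every positive integer `k`, the cardinality of `𝒫̃_k`,
viewed as a set of functions on `[0,1]` (i.e. of restrictions to `[0,1]`),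
equals `(1/k)·C(3k-2, k-1)`; equivalently `k` times it is `C(3k-2, k-1)`. -/
theorem stmt8 (k : ℕ) (hk : 0 < k) :
    k * Nat.card
        ((fun f : ℝ → ℝ => (Set.Icc (0:ℝ) 1).restrict f) '' {f | IsPtilde k f})
      = (3 * k - 2).choose (k - 1) := by
  have himage : (fun f : ℝ → ℝ => (Set.Icc (0:ℝ) 1).restrict f) '' {f | IsPtilde k f} =
      (fun w => (Set.Icc (0:ℝ) 1).domRestrict (functionOfSeq k w)) ''
        halfBoundedSeq (2 * (k - 1)) (k - 1) := by
    ext g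
    constructor
    · rintro ⟨f, hf, rfl⟩
      obtain ⟨w, hw, h⟩ := exists_functionOfSeq_eq hk hf
      exact ⟨w, hw, funext fun x => h x x.2⟩
    · rintro ⟨w, hw, rfl⟩
      exact ⟨functionOfSeq k w, isPtilde_functionOfSeq hk hw, rfl⟩
  rw [himage, Nat.card_coe_set_eq, (injOn_domRestrict_functionOfSeq hk).ncard_image]
  obtain ⟨n, rfl⟩ := Nat.exists_eq_add_of_le' hk
  rw [show 3 * (n + 1) - 2 = 3 * n + 1 by omega, Nat.add_sub_cancel]
  exact succ_mul_ncard_halfBoundedSeq n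
end

section
/- For every positive integer k, the number of continuous functions in 𝒫̃_k equals the k-th Catalan number C_k = (1/(k+1))·C(2k, k). -/
open Filter Set

/-- Lattice paths from `(0, 0)` to `(n, m)` staying weakly below the diagonal, encoded by their
height functions (constantly `m` from abscissa `n` on). -/
def ballotPaths (n m : ℕ) : Set (ℕ → ℕ) :=
  {b | Monotone b ∧ (∀ i, b i ≤ i) ∧ ∀ i, n ≤ i → b i = m}

theorem ballotPaths_zero_right (n : ℕ) : ballotPaths n 0 = {fun _ => 0} := by
  ext b
  simp only [ballotPaths, mem_ofPred_eq, mem_singleton_iff]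
  constructor
  · rintro ⟨hm, -, ht⟩
    funext i
    have := hm (le_max_left i n)
    rw [ht _ (le_max_right i n)] at this
    omega
  · rintro rfl
    exact ⟨monotone_const, fun i => Nat.zero_le i, fun _ _ => rfl⟩

theorem ballotPaths_eq_empty {n m : ℕ} (h : n < m) : ballotPaths n m = ∅ := by
  rw [Set.eq_empty_iff_forall_notMem]
  rintro b ⟨-, hb, ht⟩
  have h1 := hb n
  rw [ht n le_rfl] at h1
  omega

theorem ballotPaths_le {n m : ℕ} {b : ℕ → ℕ} (hb : b ∈ ballotPaths n m) (i : ℕ) : b i ≤ m := by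
  have := hb.1 (le_max_left i n)
  rwa [hb.2.2 _ (le_max_right i n)] at this

theorem ballotPaths_finite (n m : ℕ) : (ballotPaths n m).Finite := by
  have hinj : InjOn (fun (b : ℕ → ℕ) (i : Fin n) => b i) (ballotPaths n m) := by
    intro b hb b' hb' h
    funext i
    by_cases hi : i < n
    · exact congrFun h ⟨i, hi⟩
    · rw [hb.2.2 i (by omega), hb'.2.2 i (by omega)]
  refine Set.Finite.of_finite_image ?_ hinj
  refine (Set.Finite.pi' (fun _ : Fin n => Set.finite_Iic m)).subset ?_
  rintro _ ⟨b, hb, rfl⟩ i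
  exact ballotPaths_le hb i

/-- Raising the end point of a path by one step. -/
theorem ballotPaths_diff {n m : ℕ} (hmn : m ≤ n) :
    ballotPaths (n + 1) (m + 1) \ ballotPaths n (m + 1) =
      (fun (b : ℕ → ℕ) i => if i ≤ n then b i else m + 1) '' ballotPaths (n + 1) m := by
  ext b
  constructor
  · rintro ⟨hb, hb'⟩
    have hbn : b n ≤ m := by
      by_contra hcon
      refine hb' ⟨hb.1, hb.2.1, fun i hi => le_antisymm (ballotPaths_le hb i) ?_⟩
      have := hb.1 hi
      omega
    refine ⟨fun i => min (b i) m, ⟨?_, ?_, ?_⟩, ?_⟩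
    · exact fun i j hij => min_le_min (hb.1 hij) le_rfl
    · exact fun i => (min_le_left _ _).trans (hb.2.1 i)
    · intro i hi
      simp [hb.2.2 i hi]
    · funext i
      by_cases hi : i ≤ n
      · simpa [hi] using (hb.1 hi).trans hbn
      · simp [hi, hb.2.2 i (by omega)]
  · rintro ⟨b, hb, rfl⟩
    refine ⟨⟨?_, ?_, ?_⟩, ?_⟩
    · intro i j hij
      have h1 := hb.1 hij
      have h2 := ballotPaths_le hb i
      dsimp only
      split_ifs <;> omega
    · intro i
      have h1 := hb.2.1 i
      dsimp only
      split_ifs <;> omega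
    · intro i hi
      dsimp only
      rw [if_neg (by omega)]
    · rintro ⟨-, -, h⟩
      have h1 := h n le_rfl
      have h2 := ballotPaths_le hb n
      simp only [le_refl, if_true] at h1
      omega

theorem ncard_ballotPaths_succ_succ {n m : ℕ} (hmn : m ≤ n) :
    (ballotPaths (n + 1) (m + 1)).ncard =
      (ballotPaths (n + 1) m).ncard + (ballotPaths n (m + 1)).ncard := by
  have hsub : ballotPaths n (m + 1) ⊆ ballotPaths (n + 1) (m + 1) :=
    fun b hb => ⟨hb.1, hb.2.1, fun i hi => hb.2.2 i (by omega)⟩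
  rw [← Set.ncard_sdiff_add_ncard_of_subset hsub (ballotPaths_finite _ _), ballotPaths_diff hmn,
    Set.InjOn.ncard_image]
  intro b hb b' hb' h
  funext i
  by_cases hi : i ≤ n
  · simpa [hi] using congrFun h i
  · rw [hb.2.2 i (by omega), hb'.2.2 i (by omega)]

/-- The ballot numbers. -/
theorem succ_mul_ncard_ballotPaths (n m : ℕ) (hmn : m ≤ n + 1) :
    (n + 1) * (ballotPaths n m).ncard = (n + 1 - m) * (n + m).choose m := by
  induction m generalizing n with
  | zero => simp [ballotPaths_zero_right]
  | succ m ihm =>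
    induction n with
    | zero =>
      rw [ballotPaths_eq_empty (by omega)]
      simp
    | succ n ihn =>
      rcases Nat.lt_or_ge n m with h | h
      · rw [ballotPaths_eq_empty (by omega), show n + 1 + 1 - (m + 1) = 0 by omega]
        simp
      · have h1 := ihm (n + 1) (by omega)
        have h2 := ihn (by omega)
        rw [ncard_ballotPaths_succ_succ h]
        generalize (ballotPaths (n + 1) m).ncard = x at *
        generalize (ballotPaths n (m + 1)).ncard = y at *
        obtain ⟨d, rfl⟩ := Nat.exists_eq_add_of_le h
        rw [show m + d + 1 + 1 - m = d + 2 by omega] at h1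
        rw [show m + d + 1 - (m + 1) = d by omega] at h2
        rw [show m + d + 1 + 1 - (m + 1) = d + 1 by omega]
        have hp : (m + d + 1 + (m + 1)).choose (m + 1) =
            (m + d + 1 + m).choose m + (m + d + (m + 1)).choose (m + 1) := by
          rw [show m + d + (m + 1) = m + d + 1 + m by omega]
          exact Nat.choose_succ_succ _ _
        have hq : (m + d + (m + 1)).choose (m + 1) * (m + 1) =
            (m + d + 1 + m).choose m * (m + d + 1) := by
          rw [show m + d + (m + 1) = m + d + 1 + m by omega, Nat.choose_succ_right_eq]
          congr 1
          omega
        rw [hp]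
        generalize (m + d + 1 + m).choose m = u at *
        generalize (m + d + (m + 1)).choose (m + 1) = v at *
        have hpos : 0 < m + d + 1 := by omega
        zify at *
        apply mul_left_cancel₀ (show ((m : ℤ) + d + 1) ≠ 0 by omega)
        linear_combination (m + d + 1 : ℤ) * h1 + (m + d + 2 : ℤ) * h2 - hq

/-- The continuous function on `[0, n]` with value `c j` at each integer `j`, affine in between
(up to the constant `c 0`). -/
noncomputable def interpolant (c : ℕ → ℝ) (n : ℕ) (y : ℝ) : ℝ :=
  ∑ i ∈ Finset.range n, (c (i + 1) - c i) * max 0 (min 1 (y - i))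

theorem continuous_interpolant (c : ℕ → ℝ) (n : ℕ) : Continuous (interpolant c n) := by
  unfold interpolant
  fun_prop

theorem monotone_interpolant {c : ℕ → ℝ} (hc : Monotone c) (n : ℕ) :
    Monotone (interpolant c n) := by
  intro x y hxy
  refine Finset.sum_le_sum fun i _ => ?_
  have := sub_nonneg.2 (hc (Nat.le_succ i))
  have h2 : max 0 (min 1 (x - i)) ≤ max 0 (min 1 (y - i)) := by gcongr
  exact mul_le_mul_of_nonneg_left h2 this

theorem interpolant_eq (c : ℕ → ℝ) {n j : ℕ} (hj : j < n) {y : ℝ} (h1 : (j : ℝ) ≤ y)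
    (h2 : y ≤ j + 1) :
    interpolant c n y = c j - c 0 + (c (j + 1) - c j) * (y - j) := by
  have hsub : Finset.range (j + 1) ⊆ Finset.range n := Finset.range_mono hj
  rw [interpolant, ← Finset.sum_subset hsub, Finset.sum_range_succ,
    Finset.sum_congr rfl (g := fun i => c (i + 1) - c i), Finset.sum_range_sub,
    min_eq_right (by linarith), max_eq_right (by linarith)]
  · intro i hi
    have : (i : ℝ) + 1 ≤ j := by exact_mod_cast Finset.mem_range.1 hi
    rw [min_eq_left (by linarith), max_eq_right zero_le_one, mul_one]
  · intro i _ hi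
    have : (j : ℝ) + 1 ≤ i := by
      have : ¬ i < j + 1 := fun h => hi (Finset.mem_range.2 h)
      exact_mod_cast not_lt.1 this
    rw [max_eq_left ((min_le_right _ _).trans (by linarith)), mul_zero]

theorem interpolant_natCast (c : ℕ → ℝ) {n j : ℕ} (hj : j ≤ n) :
    interpolant c n j = c j - c 0 := by
  rcases hj.lt_or_eq with h | rfl
  · rw [interpolant_eq c h le_rfl (by linarith)]
    ring
  · rcases j with _ | j
    · simp [interpolant]
    · rw [interpolant_eq c (Nat.lt_succ_self j) (by push_cast; linarith) (by push_cast; linarith)]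
      push_cast
      ring

/-- The decreasing piecewise affine function with `f (j / k) = 1 - b (j - 1) / k`. -/
noncomputable def pathFun (k : ℕ) (b : ℕ → ℕ) (x : ℝ) : ℝ :=
  1 - interpolant (fun j => (b (j - 1) : ℝ)) k (k * x) / k

section pathFun

variable {k : ℕ} {b : ℕ → ℕ}

theorem continuous_pathFun (k : ℕ) (b : ℕ → ℕ) : Continuous (pathFun k b) := by
  have := continuous_interpolant (fun j => (b (j - 1) : ℝ)) k
  unfold pathFun
  fun_prop

theorem antitone_pathFun (hb : Monotone b) : Antitone (pathFun k b) := by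
  intro x y hxy
  have hc : Monotone (fun j => (b (j - 1) : ℝ)) := fun i j hij =>
    Nat.cast_le.2 (hb (Nat.sub_le_sub_right hij 1))
  have : interpolant (fun j => (b (j - 1) : ℝ)) k (k * x) ≤
      interpolant (fun j => (b (j - 1) : ℝ)) k (k * y) :=
    monotone_interpolant hc k (by gcongr)
  unfold pathFun
  gcongr

theorem pathFun_eq (hb : b 0 = 0) {j : ℕ} (hj : j < k) {x : ℝ}
    (h1 : (j : ℝ) ≤ k * x) (h2 : k * x ≤ j + 1) :
    pathFun k b x = 1 - ((b (j - 1) : ℝ) + ((b j : ℝ) - b (j - 1)) * (k * x - j)) / k := by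
  rw [pathFun, interpolant_eq _ hj h1 h2]
  simp [hb]

theorem pathFun_div (hk : 0 < k) (hb : b 0 = 0) {j : ℕ} (hj : j ≤ k) :
    pathFun k b (j / k) = 1 - (b (j - 1) : ℝ) / k := by
  have hk' : (k : ℝ) ≠ 0 := by positivity
  rw [pathFun, mul_div_cancel₀ _ hk', interpolant_natCast _ hj]
  simp [hb]

theorem one_sub_lt_pathFun (hk : 0 < k) (hb : b ∈ ballotPaths k k) {a : ℝ}
    (ha : a ∈ Ioo (0 : ℝ) 1) :
    1 - a < pathFun k b a := by
  have hk' : (0 : ℝ) < k := by positivity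
  have hb0 : b 0 = 0 := Nat.le_zero.1 (hb.2.1 0)
  have hy : 0 < k * a := mul_pos hk' ha.1
  have hj1 : ((⌊k * a⌋₊ : ℕ) : ℝ) ≤ k * a := Nat.floor_le hy.le
  have hj2 : k * a < (⌊k * a⌋₊ : ℕ) + 1 := Nat.lt_floor_add_one _
  have hjk : ⌊k * a⌋₊ < k := (Nat.floor_lt hy.le).2 (by nlinarith [ha.2])
  generalize ⌊k * a⌋₊ = j at *
  rw [pathFun_eq hb0 hjk hj1 hj2.le]
  suffices h : (b (j - 1) : ℝ) + ((b j : ℝ) - b (j - 1)) * (k * a - j) < k * a by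
    have := (div_lt_iff₀ hk').2 (h.trans_eq (mul_comm _ _))
    linarith
  rcases j with _ | j
  · simpa [hb0] using hy
  · have e1 : (b j : ℝ) ≤ j := by exact_mod_cast hb.2.1 j
    have e2 : (b (j + 1) : ℝ) ≤ j + 1 := by exact_mod_cast hb.2.1 (j + 1)
    simp only [Nat.add_sub_cancel]
    push_cast at *
    nlinarith [mul_le_mul_of_nonneg_right e1 (by linarith : (0 : ℝ) ≤ 1 - (k * a - (j + 1))),
      mul_le_mul_of_nonneg_right e2 (by linarith : (0 : ℝ) ≤ (k * a - (j + 1)))]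

theorem pathFun_affine (hk : 0 < k) (hb : b ∈ ballotPaths k k) {i : ℕ} (h1 : 1 ≤ i) (h2 : i ≤ k) :
    ∃ (s : ℤ) (t : ℝ), s ≤ 0 ∧ ∀ x ∈ Ioo (((i : ℝ) - 1) / k) ((i : ℝ) / k),
      pathFun k b x = (s : ℝ) * x + t := by
  have hk' : (0 : ℝ) < k := by positivity
  have hb0 : b 0 = 0 := Nat.le_zero.1 (hb.2.1 0)
  obtain ⟨j, rfl⟩ := Nat.exists_eq_add_of_le' h1
  refine ⟨(b (j - 1) : ℤ) - b j, 1 - ((b (j - 1) : ℝ) - ((b j : ℝ) - b (j - 1)) * j) / k, ?_, ?_⟩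
  · have := hb.1 (Nat.sub_le j 1)
    omega
  · rintro x ⟨hx1, hx2⟩
    rw [div_lt_iff₀ hk'] at hx1
    rw [lt_div_iff₀ hk'] at hx2
    push_cast at hx1 hx2
    rw [pathFun_eq hb0 (j := j) (by omega) (by linarith) (by linarith)]
    push_cast
    field_simp
    ring

theorem isPtilde_pathFun (hk : 0 < k) (hb : b ∈ ballotPaths k k) : IsPtilde k (pathFun k b) := by
  have hk' : (0 : ℝ) < k := by positivity
  have hb0 : b 0 = 0 := Nat.le_zero.1 (hb.2.1 0)
  have hanti : Antitone (pathFun k b) := antitone_pathFun hb.1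
  have hf0 : pathFun k b 0 = 1 := by
    simpa [hb0] using pathFun_div hk hb0 (Nat.zero_le k)
  have hf1 : 0 < pathFun k b 1 := by
    have h := pathFun_div hk hb0 (le_refl k)
    rw [div_self hk'.ne'] at h
    rw [h, sub_pos, div_lt_one hk']
    have := hb.2.1 (k - 1)
    exact_mod_cast (by omega : b (k - 1) < k)
  refine ⟨⟨k - 1, fun i => (i : ℚ) / k, ?_, ?_, ?_, ?_, ?_, ?_, ?_, hf1, ?_⟩, ?_, ?_, ?_⟩
  · exact fun x hx => ⟨hf1.le.trans (hanti hx.2), (hanti hx.1).trans_eq hf0⟩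
  · exact fun x y _ hxy _ => hanti hxy
  · simp
  · rw [Nat.sub_add_cancel hk]
    exact div_self (by positivity)
  · intro i j hij _
    have : (i : ℚ) < j := by exact_mod_cast hij
    dsimp only
    gcongr
  · intro i h1 h2
    obtain ⟨s, t, -, h⟩ := pathFun_affine hk hb h1 (by omega)
    refine ⟨s, t, ?_⟩
    push_cast [h1]
    exact h
  · refine ⟨1 / k, by positivity, fun x hx0 hx => ?_⟩
    rw [lt_div_iff₀ hk'] at hx
    rw [pathFun_eq hb0 (j := 0) hk (by push_cast; positivity) (by push_cast; linarith)]
    simp [hb0]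
  · intro a ha
    exact ⟨_, ((continuous_pathFun k b).tendsto a).mono_left nhdsWithin_le_nhds,
      one_sub_lt_pathFun hk hb ha⟩
  · intro i _ hi
    refine ⟨k - b (i - 1), ?_⟩
    rw [pathFun_div hk hb0 hi]
    push_cast
    field_simp
  · exact (continuous_pathFun k b).upperSemicontinuous.upperSemicontinuousOn _
  · exact fun i => pathFun_affine hk hb

theorem injOn_domRestrict_pathFun (hk : 0 < k) :
    InjOn (fun b => (Icc (0 : ℝ) 1).domRestrict (pathFun k b)) (ballotPaths k k) := by
  have hk' : (0 : ℝ) < k := by positivity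
  intro b hb b' hb' h
  funext i
  by_cases hi : i < k
  · have hmem : ((i + 1 : ℕ) : ℝ) / k ∈ Icc (0 : ℝ) 1 :=
      ⟨by positivity, (div_le_one hk').2 (by exact_mod_cast hi)⟩
    have h1 : pathFun k b ((i + 1 : ℕ) / k) = pathFun k b' ((i + 1 : ℕ) / k) :=
      congrFun h ⟨_, hmem⟩
    rw [pathFun_div hk (Nat.le_zero.1 (hb.2.1 0)) hi,
      pathFun_div hk (Nat.le_zero.1 (hb'.2.1 0)) hi, sub_right_inj, div_left_inj' hk'.ne'] at h1
    exact_mod_cast h1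
  · rw [hb.2.2 i (by omega), hb'.2.2 i (by omega)]

end pathFun

theorem IsPtilde.eqOn_affine {k : ℕ} (hk : 0 < k) {f : ℝ → ℝ} (hf : IsPtilde k f)
    (hc : ContinuousOn f (Icc (0 : ℝ) 1)) {j : ℕ} (hj : j < k) :
    ∃ s t : ℝ, ∀ x, (j : ℝ) ≤ k * x → k * x ≤ j + 1 → f x = s * x + t := by
  have hk' : (0 : ℝ) < k := by positivity
  obtain ⟨s, t, -, h⟩ := hf.2.2.2 (j + 1) (by omega) hj
  push_cast at h
  rw [add_sub_cancel_right] at h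
  refine ⟨s, t, fun x h1 h2 => ?_⟩
  have hsub : Icc ((j : ℝ) / k) (((j : ℝ) + 1) / k) ⊆ Icc 0 1 :=
    Icc_subset_Icc (by positivity) ((div_le_one hk').2 (by exact_mod_cast hj))
  have hlt : (j : ℝ) / k < ((j : ℝ) + 1) / k := by gcongr; linarith
  have key : EqOn f (fun x => (s : ℝ) * x + t) (Icc ((j : ℝ) / k) (((j : ℝ) + 1) / k)) :=
    Set.EqOn.of_subset_closure h (hc.mono hsub) (by fun_prop) Ioo_subset_Icc_self
      (closure_Ioo hlt.ne).ge
  exact key ⟨(div_le_iff₀ hk').2 (by linarith), (le_div_iff₀ hk').2 (by linarith)⟩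

theorem IsPtilde.exists_path {k : ℕ} (hk : 0 < k) {f : ℝ → ℝ} (hf : IsPtilde k f)
    (hc : ContinuousOn f (Icc (0 : ℝ) 1)) :
    ∃ b ∈ ballotPaths k k, EqOn (pathFun k b) f (Icc (0 : ℝ) 1) := by
  have hk' : (0 : ℝ) < k := by positivity
  obtain ⟨m, ρ, hrange, hanti, -, -, -, -, ⟨ε, hε, hf1⟩, hfpos, hlim⟩ := hf.1
  have hmem : ∀ j ≤ k, (j : ℝ) / k ∈ Icc (0 : ℝ) 1 := fun j hj =>
    ⟨by positivity, (div_le_one hk').2 (by exact_mod_cast hj)⟩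
  have hf0 : f 0 = 1 := hf1 0 le_rfl hε
  have hfk : f (1 / k) = 1 := by
    obtain ⟨s, t, h⟩ := hf.eqOn_affine hk hc hk
    simp only [Nat.cast_zero, zero_add] at h
    have hd0 : 0 < min (ε / 2) (1 / k) := by positivity
    have hd1 : min (ε / 2) (1 / (k : ℝ)) ≤ 1 / k := min_le_right _ _
    have hd2 : min (ε / 2) (1 / (k : ℝ)) ≤ ε / 2 := min_le_left _ _
    generalize min (ε / 2) (1 / (k : ℝ)) = δ at *
    have e0 := h 0 (by simp) (by simp)
    have e1 := h δ (by positivity) (by rw [le_div_iff₀ hk'] at hd1; linarith)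
    rw [hf1 δ hd0.le (by linarith)] at e1
    have hs : s * δ = 0 := by linarith
    have hs0 : s = 0 := (mul_eq_zero.1 hs).resolve_right hd0.ne'
    rw [h (1 / k) (by positivity) (by field_simp; rfl), hs0]
    rw [hs0] at e1
    linarith
  have hz : ∀ i : ℕ, ∃ z : ℕ, i < k → (k : ℝ) * f ((i + 1 : ℕ) / k) = k - z := by
    intro i
    by_cases hi : i < k
    · obtain ⟨z, hz⟩ := hf.2.1 (i + 1) (by omega) hi
      have h1 := (hrange _ (hmem (i + 1) hi)).2
      have h2 : (z : ℝ) ≤ k := by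
        rw [← hz]
        nlinarith
      have h3 : 0 ≤ (k : ℤ) - z := by
        have : z ≤ (k : ℤ) := by exact_mod_cast h2
        omega
      obtain ⟨w, hw⟩ := Int.eq_ofNat_of_zero_le h3
      refine ⟨w, fun _ => ?_⟩
      have hw' : (k : ℝ) - z = w := by exact_mod_cast hw
      linarith
    · exact ⟨0, fun h => absurd h hi⟩
  choose z hz using hz
  have hz0 : z 0 = 0 := by
    have h := hz 0 hk
    simp only [zero_add, Nat.cast_one, hfk] at h
    have : (z 0 : ℝ) = 0 := by linarith
    exact_mod_cast this
  have hzle : ∀ i < k, z i ≤ i := by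
    intro i hi
    have h := hz i hi
    have hlt : (z i : ℝ) < (i + 1 : ℕ) := by
      rcases Nat.lt_or_ge (i + 1) k with hik | hik
      · have ha : ((i + 1 : ℕ) : ℝ) / k ∈ Ioo (0 : ℝ) 1 :=
          ⟨by positivity, (div_lt_one hk').2 (by exact_mod_cast hik)⟩
        obtain ⟨L, hL, hL'⟩ := hlim _ ha
        have hcont : ContinuousAt f (((i + 1 : ℕ) : ℝ) / k) :=
          hc.continuousAt (Icc_mem_nhds ha.1 ha.2)
        rw [tendsto_nhds_unique hL (hcont.tendsto.mono_left nhdsWithin_le_nhds)] at hL'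
        have := mul_lt_mul_of_pos_left hL' hk'
        rw [mul_sub, mul_div_cancel₀ _ hk'.ne', h] at this
        linarith
      · obtain rfl : k = i + 1 := by omega
        rw [div_self hk'.ne'] at h
        have := mul_pos hk' hfpos
        linarith
    have : z i < i + 1 := by exact_mod_cast hlt
    omega
  have hzmono : ∀ i j, i ≤ j → j < k → z i ≤ z j := by
    intro i j hij hj
    have h1 := hz i (by omega)
    have h2 := hz j hj
    have h3 := hanti (((i + 1 : ℕ) : ℝ) / k) (((j + 1 : ℕ) : ℝ) / k) (by positivity)
      (by gcongr) (hmem _ hj).2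
    have := mul_le_mul_of_nonneg_left h3 hk'.le
    have h4 : (z i : ℝ) ≤ z j := by linarith
    exact_mod_cast h4
  have hb : (fun i => if i < k then z i else k) ∈ ballotPaths k k := by
    refine ⟨fun i j hij => ?_, fun i => ?_, fun i hi => if_neg (by omega)⟩
    · dsimp only
      split_ifs with h1 h2
      · exact hzmono i j hij h2
      · have := hzle i h1
        omega
      · omega
      · exact le_rfl
    · dsimp only
      split_ifs with h1
      · exact hzle i h1
      · omega
  refine ⟨_, hb, ?_⟩
  have hnode : ∀ j ≤ k, pathFun k (fun i => if i < k then z i else k) (j / k) = f (j / k) := by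
    intro j hj
    rw [pathFun_div hk (Nat.le_zero.1 (hb.2.1 0)) hj]
    rcases j with _ | j
    · simp [hk, hz0, hf0]
    · rw [Nat.add_sub_cancel, if_pos (by omega)]
      have := hz j hj
      field_simp
      linarith
  have hinterp : ∀ j < k, ∀ x : ℝ, (j : ℝ) ≤ k * x → k * x ≤ j + 1 →
      pathFun k (fun i => if i < k then z i else k) x = f x := by
    intro j hj x h1 h2
    obtain ⟨s, t, h⟩ := hf.eqOn_affine hk hc hj
    obtain ⟨s', t', h'⟩ := (isPtilde_pathFun hk hb).eqOn_affine hk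
      (continuous_pathFun k _).continuousOn hj
    have e1 := hnode j hj.le
    have e2 := hnode (j + 1) hj
    have c1 : (k : ℝ) * (j / k) = j := mul_div_cancel₀ _ hk'.ne'
    have c2 : (k : ℝ) * ((j + 1 : ℕ) / k) = j + 1 := by
      rw [mul_div_cancel₀ _ hk'.ne']
      push_cast
      rfl
    rw [h _ c1.ge (by linarith), h' _ c1.ge (by linarith)] at e1
    rw [h _ (by linarith) c2.le, h' _ (by linarith) c2.le] at e2
    rw [h x h1 h2, h' x h1 h2]
    have hs : s' = s := by
      push_cast at e2
      field_simp at e1 e2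
      linarith
    subst hs
    linarith
  rintro x ⟨hx0, hx1⟩
  rcases hx1.lt_or_eq with hx | rfl
  · have hy : 0 ≤ k * x := by positivity
    exact hinterp ⌊k * x⌋₊ ((Nat.floor_lt hy).2 (by nlinarith)) x (Nat.floor_le hy)
      (Nat.lt_floor_add_one _).le
  · have := hnode k le_rfl
    rwa [div_self hk'.ne'] at this

/-- for every positive integer `k`, the number of continuous
functions in `𝒫̃_k` (viewed as a set of functions on `[0,1]`, i.e. of
restrictions to `[0,1]`) equals the `k`-th Catalan number
`C_k = (1/(k+1))·C(2k,k)`; equivalently `k+1` times it is `C(2k, k)`. -/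
theorem stmt9 (k : ℕ) (hk : 0 < k) :
    (k + 1) * Nat.card
        ((fun f : ℝ → ℝ => (Set.Icc (0:ℝ) 1).restrict f) ''
          {f | IsPtilde k f ∧ ContinuousOn f (Set.Icc (0:ℝ) 1)})
      = (2 * k).choose k := by
  have himage : ((fun f : ℝ → ℝ => (Set.Icc (0:ℝ) 1).restrict f) ''
      {f | IsPtilde k f ∧ ContinuousOn f (Set.Icc (0:ℝ) 1)}) =
      (fun b => (Set.Icc (0:ℝ) 1).domRestrict (pathFun k b)) '' ballotPaths k k := by
    ext g
    constructor
    · rintro ⟨f, ⟨hf, hc⟩, rfl⟩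
      obtain ⟨b, hb, h⟩ := hf.exists_path hk hc
      exact ⟨b, hb, Set.domRestrict_eq_domRestrict_iff.2 h⟩
    · rintro ⟨b, hb, rfl⟩
      exact ⟨pathFun k b, ⟨isPtilde_pathFun hk hb, (continuous_pathFun k b).continuousOn⟩, rfl⟩
  rw [himage, Nat.card_coe_set_eq, Set.InjOn.ncard_image (injOn_domRestrict_pathFun hk),
    succ_mul_ncard_ballotPaths k k (Nat.le_succ k), Nat.add_sub_cancel_left, one_mul, two_mul]
end

section
/- Let λ = (λ_1 ≥ ⋯ ≥ λ_n) be a nonempty partition with exactly n parts, λ_1 = n, and λ_i ≥ n+1−i for all i (so RP(λ) ≠ ∅). Let g := #{ i ∈ {1,…,n−1} : λ_{i+1} = n − i } be the number of ground bumps of λ. Then there exist real numbers α_3, α_4 > 0 such that #RP(N⊙λ) / ( N^{n·N + (g+1)/2} · α_3^N · α_4 ) → 1 as N → ∞. -/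
/-- The number of injections `Fin k → Fin M` dominated by a monotone bound is a product. -/
theorem card_injective_lt_eq_prod (M : ℕ) (c : ℕ → ℕ) (k : ℕ)
    (hc : ∀ i j, i ≤ j → j < k → c i ≤ c j) (hM : ∀ i < k, c i ≤ M) :
    Nat.card {f : Fin k → Fin M // Function.Injective f ∧ ∀ i, (f i : ℕ) < c i} =
      ∏ i ∈ Finset.range k, (c i - i) := by
  induction k with
  | zero =>
    rw [Finset.prod_range_zero, Nat.card_eq_one_iff_unique]
    refine ⟨⟨fun f g => Subtype.ext (Subsingleton.elim _ _)⟩,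
      ⟨⟨Fin.elim0, fun i => i.elim0, fun i => i.elim0⟩⟩⟩
  | succ k ih =>
    have e : {f : Fin (k + 1) → Fin M // Function.Injective f ∧ ∀ i, (f i : ℕ) < c i} ≃
        Σ f : {f : Fin k → Fin M // Function.Injective f ∧ ∀ i, (f i : ℕ) < c i},
          {x : Fin M // (x : ℕ) < c k ∧ x ∉ Set.range f.1} :=
      { toFun := fun f => ⟨⟨fun i => f.1 i.castSucc,
            f.2.1.comp (Fin.castSucc_injective k), fun i => f.2.2 i.castSucc⟩,
            ⟨f.1 (Fin.last k), f.2.2 (Fin.last k), by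
              rintro ⟨i, hi⟩
              exact (Fin.castSucc_lt_last i).ne (f.2.1 hi)⟩⟩
        invFun := fun p => ⟨Fin.snoc (α := fun _ => Fin M) p.1.1 p.2.1, by
            rw [Fin.snoc_injective_iff]
            exact ⟨p.1.2.1, p.2.2.2⟩, by
            intro i
            refine Fin.lastCases ?_ (fun j => ?_) i
            · simpa using p.2.2.1
            · simpa using p.1.2.2 j⟩
        left_inv := by
          intro f
          apply Subtype.ext
          exact Fin.snoc_init_self f.1
        right_inv := by
          rintro ⟨⟨f, hf⟩, ⟨x, hx⟩⟩
          refine Sigma.subtype_ext ?_ ?_ <;> simp }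
    rw [Nat.card_congr e, Nat.card_sigma, Finset.prod_range_succ,
      ← ih (fun i j hij hj => hc i j hij (by omega)) (fun i hi => hM i (by omega))]
    have key : ∀ f : {f : Fin k → Fin M // Function.Injective f ∧ ∀ i, (f i : ℕ) < c i},
        Nat.card {x : Fin M // (x : ℕ) < c k ∧ x ∉ Set.range f.1} = c k - k := by
      rintro ⟨f, hf, hfc⟩
      have hsub : Finset.univ.image f ⊆
          Finset.univ.filter (fun x : Fin M => (x : ℕ) < c k) := by
        intro x hx
        obtain ⟨i, -, rfl⟩ := Finset.mem_image.1 hx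
        simpa using (hfc i).trans_le (hc i k i.2.le (by omega))
      have h2 : (Finset.univ.filter (fun x : Fin M => (x : ℕ) < c k)).card = c k := by
        have := hM k (by omega)
        simp [Fin.card_filter_val_lt, this]
      have h3 := Finset.card_sdiff_of_subset hsub
      rw [h2, Finset.card_image_of_injective _ hf, Finset.card_univ, Fintype.card_fin] at h3
      rw [← h3, Nat.card_eq_fintype_card, Fintype.card_subtype]
      congr 1
      ext x
      simp
    rw [Finset.sum_congr rfl fun f _ => key f, Finset.sum_const, Finset.card_univ,
      smul_eq_mul, Nat.card_eq_fintype_card]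

theorem card_perm_lt_eq_prod (m : ℕ) (c : ℕ → ℕ)
    (hc : ∀ i j, i ≤ j → j < m → c i ≤ c j) (hM : ∀ i < m, c i ≤ m) :
    Nat.card {π : Equiv.Perm (Fin m) // ∀ i, (π i : ℕ) < c i} =
      ∏ i ∈ Finset.range m, (c i - i) := by
  rw [← card_injective_lt_eq_prod m c m hc hM]
  refine Nat.card_congr
    { toFun := fun π => ⟨π.1, π.1.injective, π.2⟩
      invFun := fun f => ⟨Equiv.ofBijective f.1 (Finite.injective_iff_bijective.1 f.2.1), f.2.2⟩
      left_inv := fun π => Subtype.ext (Equiv.ext fun _ => rfl)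
      right_inv := fun f => rfl }

theorem prod_range_mul_eq_prod_prod {M : Type*} [CommMonoid M] (f : ℕ → M) (n N : ℕ) :
    ∏ i ∈ Finset.range (n * N), f i =
      ∏ q ∈ Finset.range n, ∏ r ∈ Finset.range N, f (q * N + r) := by
  induction n with
  | zero => simp
  | succ n ih => rw [Nat.succ_mul, Finset.prod_range_add, ih, Finset.prod_range_succ]

open Filter Asymptotics in
theorem factorial_mul_isEquivalent_stirling (b : ℕ) (hb : 0 < b) :
    (fun N : ℕ => ((N * b).factorial : ℝ)) ~[atTop] fun N : ℕ =>
      √(2 * ((N * b : ℕ) : ℝ) * Real.pi) * (((N * b : ℕ) : ℝ) / Real.exp 1) ^ (N * b) :=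
  Stirling.factorial_isEquivalent_stirling.comp_tendsto
    (tendsto_id.atTop_mul_const' hb)

open Filter Asymptotics in
theorem exists_descFactorial_isEquivalent (b : ℕ) (hb : 0 < b) :
    ∃ α β : ℝ, 0 < α ∧ 0 < β ∧
      (fun N : ℕ => ((N * b).descFactorial N : ℝ)) ~[atTop] fun N : ℕ =>
        (N : ℝ) ^ ((N : ℝ) + if b = 1 then 1 / 2 else 0) * α ^ N * β := by
  obtain ⟨c, rfl⟩ : ∃ c, b = c + 1 := ⟨b - 1, by omega⟩
  rcases Nat.eq_zero_or_pos c with rfl | hc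
  · refine ⟨(Real.exp 1)⁻¹, √(2 * Real.pi), by positivity, by positivity, ?_⟩
    have h := Stirling.factorial_isEquivalent_stirling
    simp only [zero_add, mul_one, Nat.descFactorial_self, if_true]
    refine h.congr_right ?_
    filter_upwards [eventually_gt_atTop 0] with N hN
    have hN' : (0 : ℝ) < N := by exact_mod_cast hN
    rw [Real.rpow_add hN', Real.rpow_natCast, ← Real.sqrt_eq_rpow, div_pow, inv_pow,
      show 2 * (N : ℝ) * Real.pi = N * (2 * Real.pi) by ring, Real.sqrt_mul hN'.le]
    field_simp
  · have hc' : (0 : ℝ) < c := by exact_mod_cast hc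
    refine ⟨((c : ℝ) + 1) ^ (c + 1) / (c : ℝ) ^ c / Real.exp 1, √(((c : ℝ) + 1) / c),
      by positivity, by positivity, ?_⟩
    have h := (factorial_mul_isEquivalent_stirling (c + 1) hb).div
      (factorial_mul_isEquivalent_stirling c hc)
    refine (h.congr_left ?_).congr_right ?_
    · refine Eventually.of_forall fun N => ?_
      have h1 : N ≤ N * (c + 1) := Nat.le_mul_of_pos_right _ hb
      have h2 := Nat.factorial_mul_descFactorial h1
      have h3 : N * (c + 1) - N = N * c := by rw [Nat.mul_succ, Nat.add_sub_cancel]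
      rw [h3] at h2
      have h4 : ((N * c).factorial : ℝ) ≠ 0 := by positivity
      simp only [Pi.div_apply]
      rw [div_eq_iff h4, ← h2]
      push_cast
      ring
    · filter_upwards [eventually_gt_atTop 0] with N hN
      have hN' : (0 : ℝ) < N := by exact_mod_cast hN
      simp only [Pi.div_apply]
      rw [if_neg (by omega), add_zero, Real.rpow_natCast, mul_div_mul_comm,
        ← Real.sqrt_div' _ (by positivity), mul_comm (√_)]
      congr 1
      · push_cast
        simp only [div_pow, mul_pow, pow_mul, mul_add, pow_add, mul_one, pow_one]
        rw [← pow_mul, ← pow_mul, ← pow_mul, ← pow_mul, ← pow_mul, mul_comm c N]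
        field_simp
        simp only [mul_pow, ← pow_mul, mul_comm c N]
        ring
      · congr 1
        push_cast
        field_simp

/-- The placements of the dilated shape, counted row block by row block. -/
theorem card_dilated_placements (n : ℕ) (lam : ℕ → ℕ)
    (hdec : ∀ i j : ℕ, 1 ≤ i → i ≤ j → j ≤ n → lam j ≤ lam i)
    (h1 : lam 1 = n) (N : ℕ) (hN : 0 < N) :
    Nat.card {π : Equiv.Perm (Fin (n * N)) //
        ∀ i : Fin (n * N), (π i : ℕ) + 1 ≤ N * lam ((n * N - (i : ℕ) + N - 1) / N)} =
      ∏ q ∈ Finset.range n, (N * (lam (n - q) - q)).descFactorial N := by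
  have hq : ∀ i < n * N, i / N < n := fun i hi => (Nat.div_lt_iff_lt_mul hN).2 hi
  have hceil : ∀ i < n * N, (n * N - i + N - 1) / N = n - i / N := by
    intro i hi
    have hlt := hq i hi
    have hdm := Nat.div_add_mod i N
    have hm := Nat.mod_lt i hN
    generalize i / N = q at *
    generalize i % N = r at *
    obtain ⟨d, rfl⟩ : ∃ d, n = q + d + 1 := ⟨n - q - 1, by omega⟩
    have e1 : (q + d + 1) * N - i + N - 1 = N * (d + 1) + (N - 1 - r) := by
      have : (q + d + 1) * N = N * q + N * (d + 1) := by ring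
      have : N * (d + 1) = N * d + N := by ring
      omega
    rw [e1, Nat.mul_add_div hN, Nat.div_eq_of_lt (by omega)]
    omega
  have hcongr : ∀ π : Equiv.Perm (Fin (n * N)),
      (∀ i : Fin (n * N), (π i : ℕ) + 1 ≤ N * lam ((n * N - (i : ℕ) + N - 1) / N)) ↔
        ∀ i : Fin (n * N), (π i : ℕ) < N * lam (n - (i : ℕ) / N) := fun π =>
    forall_congr' fun i => by rw [hceil i i.2, Nat.succ_le_iff]
  rw [Nat.card_congr (Equiv.subtypeEquivRight hcongr),
    card_perm_lt_eq_prod (n * N) (fun i => N * lam (n - i / N))]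
  · rw [prod_range_mul_eq_prod_prod]
    refine Finset.prod_congr rfl fun q _ => ?_
    rw [Nat.descFactorial_eq_prod_range]
    refine Finset.prod_congr rfl fun r hr => ?_
    have hr' := Finset.mem_range.1 hr
    rw [mul_comm q N, Nat.mul_add_div hN, Nat.div_eq_of_lt hr', add_zero, Nat.mul_sub,
      Nat.sub_sub]
  · intro i j hij hj
    have := hq j hj
    have hle : i / N ≤ j / N := Nat.div_le_div_right hij
    exact Nat.mul_le_mul_left _ (hdec _ _ (Nat.sub_pos_of_lt this)
      (Nat.sub_le_sub_left hle n) (Nat.sub_le _ _))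
  · intro i hi
    have := hq i hi
    rw [mul_comm n N]
    exact Nat.mul_le_mul_left _ ((hdec 1 _ le_rfl (Nat.sub_pos_of_lt this)
      (Nat.sub_le _ _)).trans h1.le)

/-- Ground bumps, together with the endpoint, are the row blocks whose excess is one. -/
theorem card_filter_excess_eq_one (n : ℕ) (hn : 0 < n) (lam : ℕ → ℕ) (h1 : lam 1 = n) :
    ((Finset.range n).filter (fun q => lam (n - q) - q = 1)).card =
      ((Finset.Icc 1 (n - 1)).filter (fun i => lam (i + 1) = n - i)).card + 1 := by
  have himage : (Finset.range n).filter (fun q => lam (n - q) - q = 1) =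
      insert (n - 1) (((Finset.Icc 1 (n - 1)).filter
        (fun i => lam (i + 1) = n - i)).image (fun i => n - 1 - i)) := by
    ext q
    simp only [Finset.mem_filter, Finset.mem_range, Finset.mem_insert, Finset.mem_image,
      Finset.mem_Icc]
    constructor
    · rintro ⟨hq, hl⟩
      by_cases hqn : q = n - 1
      · exact Or.inl hqn
      · refine Or.inr ⟨n - 1 - q, ⟨⟨by omega, by omega⟩, ?_⟩, by omega⟩
        rw [show n - 1 - q + 1 = n - q by omega]
        omega
    · rintro (rfl | ⟨i, ⟨⟨hi1, hi2⟩, hl⟩, rfl⟩)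
      · rw [show n - (n - 1) = 1 by omega, h1]
        omega
      · rw [show n - (n - 1 - i) = i + 1 by omega, hl]
        omega
  rw [himage, Finset.card_insert_of_notMem, Finset.card_image_of_injOn]
  · intro i hi j hj hij
    simp only [Finset.coe_filter, Finset.mem_Icc, Set.mem_ofPred_eq] at hi hj hij
    omega
  · simp only [Finset.mem_image, Finset.mem_filter, Finset.mem_Icc]
    rintro ⟨i, ⟨⟨hi1, hi2⟩, -⟩, hi⟩
    omega

/-- let `λ = (λ_1 ≥ ⋯ ≥ λ_n)` be a nonempty partition with `n`
parts, `λ_1 = n` and `λ_i ≥ n+1-i` for all `i` (so rook placements exist), and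
let `g` be its number of ground bumps, `g = #{i ∈ {1,…,n-1} : λ_{i+1} = n-i}`.
Then there are reals `α₃, α₄ > 0` with
`#RP(N⊙λ) / (N^{nN + (g+1)/2} · α₃^N · α₄) → 1` as `N → ∞`.
Here `N⊙λ` is the `N`-fold dilation of `λ`, whose `j`-th part (1-based,
`1 ≤ j ≤ nN`) is `N·λ_{⌈j/N⌉}`, and `#RP(N⊙λ)` is the number of permutations
`π` of `{1,…,nN}` with `π(i) ≤ (N⊙λ)_{nN+1-i}` for all `i`. -/
theorem stmt14 (n : ℕ) (hn : 0 < n) (lam : ℕ → ℕ)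
    (hdec : ∀ i j : ℕ, 1 ≤ i → i ≤ j → j ≤ n → lam j ≤ lam i)
    (h1 : lam 1 = n)
    (hD : ∀ i : ℕ, 1 ≤ i → i ≤ n → n + 1 - i ≤ lam i)
    (g : ℕ)
    (hg : g = ((Finset.Icc 1 (n - 1)).filter (fun i => lam (i + 1) = n - i)).card) :
    ∃ α₃ α₄ : ℝ, 0 < α₃ ∧ 0 < α₄ ∧
      Filter.Tendsto (fun N : ℕ =>
          ((Nat.card {π : Equiv.Perm (Fin (n * N)) //
              ∀ i : Fin (n * N),
                (π i : ℕ) + 1 ≤ N * lam ((n * N - (i : ℕ) + N - 1) / N)} : ℕ) : ℝ) /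
            ((N : ℝ) ^ ((n : ℝ) * (N : ℝ) + ((g : ℝ) + 1) / 2) * α₃ ^ N * α₄))
        Filter.atTop (nhds 1) := by
  have hb : ∀ q ∈ Finset.range n, 0 < lam (n - q) - q := by
    intro q hq
    have hq' := Finset.mem_range.1 hq
    have := hD (n - q) (by omega) (by omega)
    omega
  choose! α β hα hβ hequiv using fun b (hb : 0 < b) => exists_descFactorial_isEquivalent b hb
  have hαpos : 0 < ∏ q ∈ Finset.range n, α (lam (n - q) - q) :=
    Finset.prod_pos fun q hq => hα _ (hb q hq)
  have hβpos : 0 < ∏ q ∈ Finset.range n, β (lam (n - q) - q) :=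
    Finset.prod_pos fun q hq => hβ _ (hb q hq)
  refine ⟨_, _, hαpos, hβpos, ?_⟩
  have hprod := Asymptotics.IsEquivalent.finsetProd fun q hq => hequiv _ (hb q hq)
  have hexp : ∀ N : ℕ, ∑ q ∈ Finset.range n,
      ((N : ℝ) + if lam (n - q) - q = 1 then 1 / 2 else 0) =
        (n : ℝ) * (N : ℝ) + ((g : ℝ) + 1) / 2 := by
    intro N
    rw [Finset.sum_add_distrib, ← Finset.sum_filter, Finset.sum_const, Finset.sum_const,
      card_filter_excess_eq_one n hn lam h1, ← hg, Finset.card_range]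
    simp only [nsmul_eq_mul]
    push_cast
    ring
  have hmain : Asymptotics.IsEquivalent Filter.atTop
      (fun N : ℕ => ((Nat.card {π : Equiv.Perm (Fin (n * N)) //
        ∀ i : Fin (n * N),
          (π i : ℕ) + 1 ≤ N * lam ((n * N - (i : ℕ) + N - 1) / N)} : ℕ) : ℝ))
      (fun N : ℕ => (N : ℝ) ^ ((n : ℝ) * (N : ℝ) + ((g : ℝ) + 1) / 2) *
        (∏ q ∈ Finset.range n, α (lam (n - q) - q)) ^ N *
          ∏ q ∈ Finset.range n, β (lam (n - q) - q)) := by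
    refine (hprod.congr_left ?_).congr_right ?_
    · filter_upwards [Filter.eventually_gt_atTop 0] with N hN
      rw [card_dilated_placements n lam hdec h1 N hN]
      simp
    · filter_upwards [Filter.eventually_gt_atTop 0] with N hN
      have hN' : (0 : ℝ) < N := by exact_mod_cast hN
      rw [Finset.prod_mul_distrib, Finset.prod_mul_distrib, Finset.prod_pow, ← hexp N,
        Real.rpow_sum_of_pos hN']
  refine (Asymptotics.isEquivalent_iff_tendsto_one ?_).1 hmain
  filter_upwards [Filter.eventually_gt_atTop 0] with N hN
  have hN' : (0 : ℝ) < N := by exact_mod_cast hN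
  positivity
end

section
/- Let N ≥ 2 be an integer and let k be an integer with 2 ≤ k ≤ N+1. Then (1/N!) · ∑_{π ∈ S_N} ( #{ i ∈ {1,…,N} : i + π(i) ≤ k } )² = k(k−1)/(2N) + k(k−1)(k−2)(3k−5)/(12N(N−1)). That is, for π uniformly random in S_N, 𝔼(X_k(π)²) equals the right-hand side. -/
open Finset

theorem Equiv.Perm.exists_apply_eq_apply_eq {α : Type*} [DecidableEq α] {i j i' j' : α}
    (h : i ≠ j) (h' : i' ≠ j') : ∃ τ : Equiv.Perm α, τ i = i' ∧ τ j = j' := by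
  refine ⟨(Equiv.swap i i').trans (Equiv.swap (Equiv.swap i i' j) j'), ?_, ?_⟩
  · have h₁ : i' ≠ Equiv.swap i i' j := fun e => h <| by
      rw [← Equiv.swap_apply_left i i'] at e
      exact (Equiv.swap i i').injective (by simpa using e)
    simp [Equiv.swap_apply_of_ne_of_ne h₁ h']
  · simp

/-- The image of a point under a uniformly random permutation is uniformly distributed. -/
theorem Equiv.Perm.card_mul_sum_apply {α : Type*} [Fintype α] [DecidableEq α]
    (g : α → ℝ) (i : α) :
    (Fintype.card α : ℝ) * ∑ π : Equiv.Perm α, g (π i)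
      = (Fintype.card α).factorial * ∑ a, g a := by
  have h (j : α) : ∑ π : Equiv.Perm α, g (π j) = ∑ π : Equiv.Perm α, g (π i) :=
    Fintype.sum_equiv (Equiv.mulRight (Equiv.swap i j)) _ _ (by simp)
  calc _ = ∑ j, ∑ π : Equiv.Perm α, g (π j) := by simp [h]
    _ = ∑ π : Equiv.Perm α, ∑ j, g (π j) := sum_comm
    _ = ∑ _π : Equiv.Perm α, ∑ a, g a := sum_congr rfl fun π _ => Equiv.sum_comp π g
    _ = _ := by simp [Fintype.card_perm]

/-- The image of a pair of distinct points under a uniformly random permutation is uniformly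
distributed on the pairs of distinct points. -/
theorem Equiv.Perm.card_mul_sum_apply_apply {α : Type*} [Fintype α] [DecidableEq α]
    (g : α → α → ℝ) {i j : α} (hij : i ≠ j) :
    (Fintype.card α : ℝ) * ((Fintype.card α : ℝ) - 1) * ∑ π : Equiv.Perm α, g (π i) (π j)
      = (Fintype.card α).factorial * ∑ a, ∑ b, if a = b then 0 else g a b := by
  set S := ∑ π : Equiv.Perm α, g (π i) (π j)
  have h (i' j' : α) (h' : i' ≠ j') : ∑ π : Equiv.Perm α, g (π i') (π j') = S := by
    obtain ⟨τ, rfl, rfl⟩ := Equiv.Perm.exists_apply_eq_apply_eq hij h'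
    exact Fintype.sum_equiv (Equiv.mulRight τ) _ _ (by simp)
  have hrow (i' : α) : ∑ j', (if i' = j' then 0 else S) = ((Fintype.card α : ℝ) - 1) * S := by
    have e (j' : α) : (if i' = j' then 0 else S) = S - if i' = j' then S else 0 := by
      split_ifs <;> simp
    simp [e, sum_sub_distrib, sub_mul]
  calc _ = ∑ i', ∑ j', (if i' = j' then 0 else S) := by
        rw [sum_congr rfl fun i' _ => hrow i']
        simp [mul_assoc]
    _ = ∑ i', ∑ j', ∑ π : Equiv.Perm α, (if π i' = π j' then 0 else g (π i') (π j')) := by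
      refine sum_congr rfl fun i' _ => sum_congr rfl fun j' _ => ?_
      by_cases e : i' = j'
      · simp [e]
      · simp [e, h i' j' e]
    _ = ∑ π : Equiv.Perm α, ∑ i', ∑ j', (if π i' = π j' then 0 else g (π i') (π j')) := by
      rw [sum_comm (s := (univ : Finset (Equiv.Perm α)))]
      exact sum_congr rfl fun i' _ => sum_comm
    _ = ∑ _π : Equiv.Perm α, ∑ a, ∑ b, (if a = b then 0 else g a b) := by
      refine sum_congr rfl fun π _ => ?_
      rw [← Equiv.sum_comp π fun a => ∑ b, if a = b then 0 else g a b]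
      exact sum_congr rfl fun i' _ =>
        Equiv.sum_comp π fun b => if π i' = b then 0 else g (π i') b
    _ = _ := by simp [Fintype.card_perm]

/-- The second moment of `∑ i, f i (π i)` for a uniformly random permutation `π`. -/
theorem Equiv.Perm.card_mul_sum_sq_sum_apply {α : Type*} [Fintype α] [DecidableEq α]
    (f : α → α → ℝ) :
    (Fintype.card α : ℝ) * ((Fintype.card α : ℝ) - 1) *
        ∑ π : Equiv.Perm α, (∑ i, f i (π i)) ^ 2
      = (Fintype.card α).factorial *
        ((Fintype.card α : ℝ) * ∑ i, ∑ a, f i a ^ 2 + (∑ i, ∑ a, f i a) ^ 2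
          - ∑ i, (∑ a, f i a) ^ 2 - ∑ a, (∑ i, f i a) ^ 2) := by
  set n : ℝ := (Fintype.card α : ℝ)
  set F : ℝ := ((Fintype.card α).factorial : ℝ)
  have hoff (i j : α) : ∑ a, ∑ b, (if a = b then 0 else f i a * f j b)
      = (∑ a, f i a) * (∑ b, f j b) - ∑ a, f i a * f j a := by
    have e (a b : α) : (if a = b then 0 else f i a * f j b)
        = f i a * f j b - if a = b then f i a * f j b else 0 := by
      split_ifs <;> simp
    simp [e, sum_sub_distrib, sum_mul_sum]
  have hterm (i j : α) : n * (n - 1) * ∑ π : Equiv.Perm α, f i (π i) * f j (π j)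
      = F * ((∑ a, f i a) * (∑ b, f j b) - ∑ a, f i a * f j a)
        + if i = j then F * (n * ∑ a, f i a ^ 2 - (∑ a, f i a) ^ 2) else 0 := by
    by_cases e : i = j
    · subst e
      have := Equiv.Perm.card_mul_sum_apply (fun a => f i a * f i a) i
      simp only [if_true, pow_two] at this ⊢
      linear_combination (n - 1) * this
    · rw [if_neg e, add_zero, ← hoff]
      exact Equiv.Perm.card_mul_sum_apply_apply (fun a b => f i a * f j b) e
  have hcol : ∑ i, ∑ j, ∑ a, f i a * f j a = ∑ a, (∑ i, f i a) ^ 2 := by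
    simp_rw [pow_two, sum_mul_sum]
    calc _ = ∑ i, ∑ a, ∑ j, f i a * f j a := sum_congr rfl fun i _ => sum_comm
      _ = _ := sum_comm
  calc _ = ∑ i, ∑ j, n * (n - 1) * ∑ π : Equiv.Perm α, f i (π i) * f j (π j) := by
        simp_rw [← mul_sum, pow_two, sum_mul_sum]
        congr 1
        rw [sum_comm]
        exact sum_congr rfl fun i _ => sum_comm
    _ = _ := by
      simp_rw [hterm, sum_add_distrib, ← mul_sum, sum_sub_distrib, hcol]
      simp only [sum_ite_eq, mem_univ, if_true, ← mul_sum, sum_sub_distrib, ← sum_mul]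
      ring

theorem sum_range_tsub_cast (m t : ℕ) :
    ∑ i ∈ range (m + t), ((m - i : ℕ) : ℝ) = m * (m + 1) / 2 := by
  induction m with
  | zero => simp
  | succ m ih =>
    rw [add_right_comm, sum_range_succ']
    simp only [Nat.add_sub_add_right, ih]
    push_cast
    ring

theorem sum_range_tsub_cast_sq (m t : ℕ) :
    ∑ i ∈ range (m + t), ((m - i : ℕ) : ℝ) ^ 2 = m * (m + 1) * (2 * m + 1) / 6 := by
  induction m with
  | zero => simp
  | succ m ih =>
    rw [add_right_comm, sum_range_succ']
    simp only [Nat.add_sub_add_right, ih]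
    push_cast
    ring


/-- let `N ≥ 2` and `2 ≤ k ≤ N+1`. With
`X_k(π) = #{i ∈ {1,…,N} : i + π(i) ≤ k}` (permutations encoded on `Fin N`, so
`i + π(i) ≤ k` reads `(i+1) + (π(i)+1) ≤ k`), the second moment of `X_k` for a
uniformly random permutation is
`(1/N!)·∑_{π ∈ S_N} X_k(π)² = k(k-1)/(2N) + k(k-1)(k-2)(3k-5)/(12N(N-1))`. -/
theorem stmt17 (N k : ℕ) (hN : 2 ≤ N) (hk2 : 2 ≤ k) (hkN : k ≤ N + 1) :
    (1 / (N.factorial : ℝ)) *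
        ∑ π : Equiv.Perm (Fin N),
          ((Finset.univ.filter
              (fun i : Fin N => (i : ℕ) + 1 + ((π i : ℕ) + 1) ≤ k)).card : ℝ) ^ 2
      = (k : ℝ) * ((k : ℝ) - 1) / (2 * (N : ℝ)) +
        (k : ℝ) * ((k : ℝ) - 1) * ((k : ℝ) - 2) * (3 * (k : ℝ) - 5) /
          (12 * (N : ℝ) * ((N : ℝ) - 1)) := by
  obtain ⟨m, rfl⟩ : ∃ m, k = m + 1 := ⟨k - 1, by omega⟩
  have hm : m ≤ N := by omega
  obtain ⟨t, ht⟩ := Nat.exists_eq_add_of_le hm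
  set f : Fin N → Fin N → ℝ :=
    fun i a => if (i : ℕ) + 1 + ((a : ℕ) + 1) ≤ m + 1 then 1 else 0 with hf
  have hrow (i : Fin N) : ∑ a, f i a = ((m - i : ℕ) : ℝ) := by
    simp only [hf]
    rw [Fin.sum_univ_eq_sum_range
      (fun a => if (i : ℕ) + 1 + (a + 1) ≤ m + 1 then (1 : ℝ) else 0), sum_boole]
    have e : (range N).filter (fun a => (i : ℕ) + 1 + (a + 1) ≤ m + 1) = range (m - i) := by
      ext a
      simp only [mem_filter, mem_range]
      omega
    rw [e, card_range]
  have hsymm (i a : Fin N) : f i a = f a i := by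
    simp only [hf, add_comm ((i : ℕ) + 1)]
  have hsq (i a : Fin N) : f i a ^ 2 = f i a := by
    simp [hf]
  have hcol (a : Fin N) : ∑ i, f i a = ((m - a : ℕ) : ℝ) := by
    simp_rw [fun i => hsymm i a, hrow]
  have h1 : ∑ i : Fin N, ((m - i : ℕ) : ℝ) = m * (m + 1) / 2 := by
    rw [Fin.sum_univ_eq_sum_range (fun i => ((m - i : ℕ) : ℝ)), ht, sum_range_tsub_cast]
  have h2 : ∑ i : Fin N, ((m - i : ℕ) : ℝ) ^ 2 = m * (m + 1) * (2 * m + 1) / 6 := by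
    rw [Fin.sum_univ_eq_sum_range (fun i => ((m - i : ℕ) : ℝ) ^ 2), ht, sum_range_tsub_cast_sq]
  have key := Equiv.Perm.card_mul_sum_sq_sum_apply f
  simp_rw [hsq, hrow, hcol, h1, h2, Fintype.card_fin] at key
  simp_rw [← sum_boole]
  change 1 / (N.factorial : ℝ) * ∑ π : Equiv.Perm (Fin N), (∑ i, f i (π i)) ^ 2 = _
  have hN' : (2 : ℝ) ≤ N := by exact_mod_cast hN
  have hN0 : (N : ℝ) ≠ 0 := by linarith
  have hN1 : (N : ℝ) - 1 ≠ 0 := by linarith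
  have hF : (N.factorial : ℝ) ≠ 0 := by exact_mod_cast N.factorial_ne_zero
  rw [one_div, inv_mul_eq_iff_eq_mul₀ hF]
  apply mul_left_cancel₀ (mul_ne_zero hN0 hN1)
  rw [key]
  push_cast
  field_simp
  ring
end

section
/- For every real ε > 0 there exist a constant C > 0 and a positive integer N_0 such that for every integer N ≥ N_0, the number of permutations π ∈ S_N satisfying | X_k(π) − k(k−1)/(2N) | < ε·N simultaneously for all k ∈ {1,…,N+1} is at least N! · ( 1 − C·(log N)/(N·log log N) ). Equivalently, for π uniformly random in S_N, ℙ( ∀ k ∈ {1,…,N+1}, |X_k(π) − k(k−1)/(2N)| < εN ) = 1 − O_ε( (log N)/(N·log log N) ) as N → ∞. -/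
/-- The symmetric group acts transitively on ordered pairs of distinct points. -/
theorem exists_perm_map_pair {α : Type*} [DecidableEq α] {a b c d : α} (hab : a ≠ b)
    (hcd : c ≠ d) : ∃ σ : Equiv.Perm α, σ a = c ∧ σ b = d := by
  refine ⟨Equiv.swap (Equiv.swap a c b) d * Equiv.swap a c, ?_, ?_⟩
  · have h : Equiv.swap a c b ≠ c := by
      intro h
      exact hab ((Equiv.swap a c).injective (by rw [h, Equiv.swap_apply_left]))
    rw [Equiv.Perm.mul_apply, Equiv.swap_apply_left, Equiv.swap_apply_of_ne_of_ne h.symm hcd]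
  · rw [Equiv.Perm.mul_apply, Equiv.swap_apply_left]

open Finset in
/-- Averaging a function of the images of two distinct points over all permutations. -/
theorem card_offDiag_mul_sum_perm {α : Type*} [Fintype α] [DecidableEq α] (g : α → α → ℝ)
    {a b : α} (hab : a ≠ b) :
    ((univ : Finset α).offDiag.card : ℝ) * ∑ π : Equiv.Perm α, g (π a) (π b)
      = (Fintype.card α).factorial * ∑ p ∈ (univ : Finset α).offDiag, g p.1 p.2 := by
  have h1 : ∀ p ∈ (univ : Finset α).offDiag,
      ∑ π : Equiv.Perm α, g (π p.1) (π p.2) = ∑ π : Equiv.Perm α, g (π a) (π b) := by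
    intro p hp
    obtain ⟨σ, h1, h2⟩ := exists_perm_map_pair hab (mem_offDiag.1 hp).2.2
    rw [← Equiv.sum_comp (Equiv.mulRight σ) (fun π : Equiv.Perm α => g (π a) (π b))]
    simp [h1, h2]
  have h2 : ∀ π : Equiv.Perm α, ∑ p ∈ (univ : Finset α).offDiag, g (π p.1) (π p.2)
      = ∑ p ∈ (univ : Finset α).offDiag, g p.1 p.2 := by
    intro π
    refine sum_equiv (Equiv.prodCongr π π) ?_ ?_
    · simp [mem_offDiag]
    · simp
  rw [← nsmul_eq_mul, ← sum_const, ← sum_congr rfl h1, sum_comm, sum_congr rfl fun π _ => h2 π,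
    sum_const, nsmul_eq_mul, card_univ, Fintype.card_perm]

open Finset in
/-- Second moment bound for `∑ a, f a (π a)` when the rows of `f` are centred. -/
theorem sum_perm_sq_le {α : Type*} [Fintype α] [DecidableEq α] (f : α → α → ℝ)
    (hf : ∀ a b, |f a b| ≤ 1) (h0 : ∀ a, ∑ b, f a b = 0) :
    ∑ π : Equiv.Perm α, (∑ a, f a (π a)) ^ 2
      ≤ 2 * Fintype.card α * (Fintype.card α).factorial := by
  have hpair : ∀ p ∈ (univ : Finset α).offDiag,
      ((univ : Finset α).offDiag.card : ℝ) * ∑ π : Equiv.Perm α, f p.1 (π p.1) * f p.2 (π p.2)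
        ≤ (Fintype.card α).factorial * Fintype.card α := by
    intro p hp
    rw [card_offDiag_mul_sum_perm (fun x y => f p.1 x * f p.2 y) (mem_offDiag.1 hp).2.2]
    gcongr
    have h1 : ∑ q ∈ (univ : Finset α).diag, f p.1 q.1 * f p.2 q.2
        + ∑ q ∈ (univ : Finset α).offDiag, f p.1 q.1 * f p.2 q.2 = 0 := by
      rw [← sum_union (disjoint_diag_offDiag _), diag_union_offDiag, sum_product,
        ← sum_mul_sum, h0, zero_mul]
    have h2 : ∑ q ∈ (univ : Finset α).diag, f p.1 q.1 * f p.2 q.2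
        = ∑ x, f p.1 x * f p.2 x := by
      rw [sum_diag]
    have h3 : -(Fintype.card α : ℝ) ≤ ∑ x, f p.1 x * f p.2 x := by
      have : ∑ _x : α, (-1 : ℝ) ≤ ∑ x, f p.1 x * f p.2 x := by
        refine sum_le_sum fun x _ => (abs_le.1 ?_).1
        rw [abs_mul]
        exact mul_le_one₀ (hf _ _) (abs_nonneg _) (hf _ _)
      simpa using this
    linarith
  have hoff : ∑ p ∈ (univ : Finset α).offDiag,
      ∑ π : Equiv.Perm α, f p.1 (π p.1) * f p.2 (π p.2)
        ≤ (Fintype.card α).factorial * Fintype.card α := by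
    rcases (univ : Finset α).offDiag.eq_empty_or_nonempty with h | h
    · rw [h, sum_empty]
      positivity
    · have hc : (0 : ℝ) < (univ : Finset α).offDiag.card := by exact_mod_cast h.card_pos
      have := sum_le_sum hpair
      rw [← mul_sum, sum_const, nsmul_eq_mul] at this
      exact le_of_mul_le_mul_left this hc
  have hdiag : ∑ π : Equiv.Perm α, ∑ a, f a (π a) * f a (π a)
      ≤ (Fintype.card α).factorial * Fintype.card α := by
    have : ∑ π : Equiv.Perm α, ∑ a, f a (π a) * f a (π a)
        ≤ ∑ _π : Equiv.Perm α, ∑ _a : α, (1 : ℝ) := by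
      refine sum_le_sum fun π _ => sum_le_sum fun a _ => (abs_le.1 ?_).2
      rw [abs_mul]
      exact mul_le_one₀ (hf _ _) (abs_nonneg _) (hf _ _)
    simpa [Fintype.card_perm] using this
  have hsplit : ∀ π : Equiv.Perm α, (∑ a, f a (π a)) ^ 2 = ∑ a, f a (π a) * f a (π a)
      + ∑ p ∈ (univ : Finset α).offDiag, f p.1 (π p.1) * f p.2 (π p.2) := by
    intro π
    rw [sq, sum_mul_sum, ← sum_product', ← diag_union_offDiag,
      sum_union (disjoint_diag_offDiag _), sum_diag]
  rw [sum_congr rfl fun π _ => hsplit π, sum_add_distrib, sum_comm (t := univ.offDiag)]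
  linarith

open Finset in
/-- Variance bound for the number of points of the graph of a random permutation in a relation. -/
theorem sum_perm_card_sub_sq_le {α : Type*} [Fintype α] [DecidableEq α] (r : α → α → Prop)
    [∀ a b, Decidable (r a b)] :
    ∑ π : Equiv.Perm α, (((univ.filter fun a => r a (π a)).card : ℝ)
        - ((∑ a, (univ.filter (r a)).card : ℕ) : ℝ) / Fintype.card α) ^ 2
      ≤ 2 * Fintype.card α * (Fintype.card α).factorial := by
  rcases isEmpty_or_nonempty α with h | h
  · simp
  have hn : (0 : ℝ) < Fintype.card α := by exact_mod_cast Fintype.card_pos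
  have hle : ∀ a, ((univ.filter (r a)).card : ℝ) / Fintype.card α ≤ 1 := by
    intro a
    rw [div_le_one hn]
    exact_mod_cast card_le_univ _
  have hnn : ∀ a, 0 ≤ ((univ.filter (r a)).card : ℝ) / Fintype.card α := fun a => by positivity
  have := sum_perm_sq_le
    (fun a b => (if r a b then (1 : ℝ) else 0) - ((univ.filter (r a)).card : ℝ) / Fintype.card α)
    (by
      intro a b
      have := hle a
      have := hnn a
      rw [abs_le]
      split_ifs <;> constructor <;> linarith)
    (by
      intro a
      rw [sum_sub_distrib, sum_boole, sum_const, nsmul_eq_mul, card_univ]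
      field_simp
      simp)
  refine le_trans (le_of_eq (sum_congr rfl fun π _ => ?_)) this
  rw [sum_sub_distrib, sum_boole, ← sum_div]
  push_cast
  rfl

/-- The number of points `(i, j)` of the `N × N` grid with `i + j ≤ k` (one-based). -/
def gridCount (N k : ℕ) : ℕ :=
  ∑ i : Fin N, (Finset.univ.filter fun j : Fin N => (i : ℕ) + 1 + ((j : ℕ) + 1) ≤ k).card

/-- The cumulative X-ray of a permutation. -/
def cumXRay {N : ℕ} (π : Equiv.Perm (Fin N)) (k : ℕ) : ℕ :=
  (Finset.univ.filter fun i : Fin N => (i : ℕ) + 1 + ((π i : ℕ) + 1) ≤ k).card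

open Finset in
theorem cumXRay_mono {N : ℕ} (π : Equiv.Perm (Fin N)) : Monotone (cumXRay π) := by
  intro k l hkl
  refine card_le_card fun i hi => ?_
  simp only [mem_filter, mem_univ, true_and] at hi ⊢
  exact hi.trans hkl

open Finset in
theorem gridCount_succ_le (N k : ℕ) : gridCount N (k + 1) ≤ gridCount N k + N := by
  have h : ∀ i : Fin N, (univ.filter fun j : Fin N => (i : ℕ) + 1 + ((j : ℕ) + 1) ≤ k + 1).card
      ≤ (univ.filter fun j : Fin N => (i : ℕ) + 1 + ((j : ℕ) + 1) ≤ k).card + 1 := by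
    intro i
    have h1 : (univ.filter fun j : Fin N => (i : ℕ) + 1 + ((j : ℕ) + 1) = k + 1).card ≤ 1 := by
      refine card_le_one.2 fun a ha b hb => ?_
      simp only [mem_filter, mem_univ, true_and] at ha hb
      ext
      omega
    refine le_trans ?_ (Nat.add_le_add_left h1 _)
    refine le_trans (card_le_card fun j hj => ?_) (card_union_le _ _)
    simp only [mem_filter, mem_univ, true_and, mem_union] at hj ⊢
    omega
  refine (sum_le_sum fun i _ => h i).trans ?_
  rw [sum_add_distrib]
  simp [gridCount]

theorem gridCount_add_le (N k l : ℕ) : gridCount N (k + l) ≤ gridCount N k + l * N := by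
  induction l with
  | zero => simp
  | succ l ih =>
    have := gridCount_succ_le N (k + l)
    rw [← add_assoc, Nat.succ_mul]
    omega

theorem gridCount_zero (N : ℕ) : gridCount N 0 = 0 := by
  simp [gridCount]

open Finset in
theorem gridCount_mul_two {N t : ℕ} (ht : t ≤ N) : gridCount N (t + 1) * 2 = (t + 1) * t := by
  have h : ∀ i : Fin N,
      (univ.filter fun j : Fin N => (i : ℕ) + 1 + ((j : ℕ) + 1) ≤ t + 1).card = t - i := by
    intro i
    have : (univ.filter fun j : Fin N => (i : ℕ) + 1 + ((j : ℕ) + 1) ≤ t + 1)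
        = univ.filter fun j : Fin N => (j : ℕ) < t - i := by
      ext j
      simp only [mem_filter, mem_univ, true_and]
      omega
    rw [this, Fin.card_filter_val_lt]
    omega
  have hs : ∀ s : ℕ, (∑ i ∈ range s, (s - i)) * 2 = (s + 1) * s := by
    intro s
    induction s with
    | zero => simp
    | succ s ih =>
      rw [sum_range_succ', sum_congr rfl fun i _ => Nat.add_sub_add_right s 1 i, add_mul, ih,
        Nat.sub_zero]
      ring
  rw [gridCount, sum_congr rfl fun i _ => h i, Fin.sum_univ_eq_sum_range (fun i => t - i) N,
    ← hs t]
  congr 1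
  refine (sum_subset (range_subset_range.2 ht) fun i _ hi => ?_).symm
  rw [mem_range] at hi
  omega

open Finset in
/-- A large deviation of the cumulative X-ray at one place persists over an interval. -/
theorem exists_window {N : ℕ} (π : Equiv.Perm (Fin N)) (hN : 0 < N) {δ : ℝ} (hδ : 0 < δ) {k : ℕ}
    (hk : 2 * δ ≤ |(cumXRay π k : ℝ) - gridCount N k / N|) :
    ∃ s, s ≤ k ∧ ∀ l ∈ Icc s (s + ⌊δ⌋₊), δ ≤ |(cumXRay π l : ℝ) - gridCount N l / N| := by
  have hN' : (0 : ℝ) < N := by exact_mod_cast hN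
  have hlip : ∀ a l : ℕ, (gridCount N (a + l) : ℝ) / N ≤ gridCount N a / N + l := by
    intro a l
    rw [div_le_iff₀ hN', add_mul, div_mul_cancel₀ _ hN'.ne']
    exact_mod_cast gridCount_add_le N a l
  have hfl : (⌊δ⌋₊ : ℝ) ≤ δ := Nat.floor_le hδ.le
  rcases le_abs.1 hk with h | h
  · refine ⟨k, le_rfl, fun l hl => le_trans ?_ (le_abs_self _)⟩
    obtain ⟨h1, h2⟩ := mem_Icc.1 hl
    obtain ⟨d, rfl⟩ := Nat.exists_eq_add_of_le h1
    have hd : (d : ℝ) ≤ ⌊δ⌋₊ := by exact_mod_cast Nat.le_of_add_le_add_left h2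
    have hm : (cumXRay π k : ℝ) ≤ cumXRay π (k + d) := by exact_mod_cast cumXRay_mono π h1
    linarith [hlip k d]
  · have hkδ : ⌊δ⌋₊ ≤ k := by
      have h0 := hlip 0 k
      rw [gridCount_zero, zero_add] at h0
      have : (0 : ℝ) ≤ cumXRay π k := Nat.cast_nonneg _
      have : (⌊δ⌋₊ : ℝ) ≤ k := by
        simp only [Nat.cast_zero, zero_div] at h0
        linarith
      exact_mod_cast this
    refine ⟨k - ⌊δ⌋₊, Nat.sub_le _ _, fun l hl => le_trans ?_ (neg_le_abs _)⟩
    obtain ⟨h1, h2⟩ := mem_Icc.1 hl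
    rw [Nat.sub_add_cancel hkδ] at h2
    obtain ⟨d, rfl⟩ := Nat.exists_eq_add_of_le h2
    have hd : (d : ℝ) ≤ ⌊δ⌋₊ := by
      have : d ≤ ⌊δ⌋₊ := by omega
      exact_mod_cast this
    have hm : (cumXRay π l : ℝ) ≤ cumXRay π (l + d) := by exact_mod_cast cumXRay_mono π h2
    linarith [hlip l d]

open Finset in
/-- The number of permutations whose cumulative X-ray deviates somewhere by at least `2 * δ`. -/
theorem card_deviation_mul_le {N : ℕ} (hN : 0 < N) {δ : ℝ} (hδ : 0 < δ)
    (B : Finset (Equiv.Perm (Fin N)))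
    (hB : ∀ π ∈ B, ∃ k ≤ N + 1, 2 * δ ≤ |(cumXRay π k : ℝ) - gridCount N k / N|) :
    (B.card : ℝ) * δ ^ 3 ≤ (N + 2 + δ) * (2 * N * N.factorial) := by
  have hlow : ∀ π ∈ B, δ ^ 3
      ≤ ∑ l ∈ range (N + 2 + ⌊δ⌋₊), ((cumXRay π l : ℝ) - gridCount N l / N) ^ 2 := by
    intro π hπ
    obtain ⟨k, hkN, hk⟩ := hB π hπ
    obtain ⟨s, hs, hw⟩ := exists_window π hN hδ hk
    have hsub : Icc s (s + ⌊δ⌋₊) ⊆ range (N + 2 + ⌊δ⌋₊) := by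
      intro l hl
      rw [mem_Icc] at hl
      rw [mem_range]
      omega
    calc δ ^ 3 = δ * δ ^ 2 := by ring
      _ ≤ (⌊δ⌋₊ + 1) * δ ^ 2 := by
        gcongr
        exact (Nat.lt_floor_add_one δ).le
      _ = ∑ _l ∈ Icc s (s + ⌊δ⌋₊), δ ^ 2 := by
        rw [sum_const, nsmul_eq_mul, Nat.card_Icc,
          show s + ⌊δ⌋₊ + 1 - s = ⌊δ⌋₊ + 1 by omega]
        push_cast
        rfl
      _ ≤ ∑ l ∈ Icc s (s + ⌊δ⌋₊), ((cumXRay π l : ℝ) - gridCount N l / N) ^ 2 := by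
        refine sum_le_sum fun l hl => ?_
        rw [← sq_abs ((cumXRay π l : ℝ) - gridCount N l / N)]
        exact pow_le_pow_left₀ hδ.le (hw l hl) 2
      _ ≤ _ := sum_le_sum_of_subset_of_nonneg hsub fun _ _ _ => sq_nonneg _
  calc (B.card : ℝ) * δ ^ 3 = ∑ _π ∈ B, δ ^ 3 := by rw [sum_const, nsmul_eq_mul]
    _ ≤ ∑ π ∈ B, ∑ l ∈ range (N + 2 + ⌊δ⌋₊), ((cumXRay π l : ℝ) - gridCount N l / N) ^ 2 :=
      sum_le_sum hlow
    _ ≤ ∑ π, ∑ l ∈ range (N + 2 + ⌊δ⌋₊), ((cumXRay π l : ℝ) - gridCount N l / N) ^ 2 :=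
      sum_le_sum_of_subset_of_nonneg (subset_univ _) fun _ _ _ =>
        sum_nonneg fun _ _ => sq_nonneg _
    _ = ∑ l ∈ range (N + 2 + ⌊δ⌋₊), ∑ π, ((cumXRay π l : ℝ) - gridCount N l / N) ^ 2 :=
      sum_comm
    _ ≤ ∑ _l ∈ range (N + 2 + ⌊δ⌋₊), (2 * N * N.factorial : ℝ) := by
      refine sum_le_sum fun l _ => ?_
      have := sum_perm_card_sub_sq_le
        (fun i j : Fin N => (i : ℕ) + 1 + ((j : ℕ) + 1) ≤ l)
      rwa [Fintype.card_fin] at this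
    _ = (N + 2 + ⌊δ⌋₊) * (2 * N * N.factorial) := by
      rw [sum_const, nsmul_eq_mul, card_range]
      push_cast
      rfl
    _ ≤ _ := by
      gcongr
      exact Nat.floor_le hδ.le

/-- limit shape for normalized cumulative X-rays of random
permutations. For every `ε > 0` there are `C > 0` and `N₀` such that for every
`N ≥ N₀`, the number of permutations `π ∈ S_N` with
`|X_k(π) - k(k-1)/(2N)| < ε·N` simultaneously for all `k ∈ {1,…,N+1}` is at
least `N!·(1 - C·(log N)/(N·log log N))`. Here
`X_k(π) = #{i ∈ {1,…,N} : i + π(i) ≤ k}` (permutations encoded on `Fin N`, so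
`i + π(i) ≤ k` reads `(i+1) + (π(i)+1) ≤ k`), and logs are natural logs. -/
theorem stmt19 (ε : ℝ) (hε : 0 < ε) :
    ∃ C : ℝ, 0 < C ∧ ∃ N₀ : ℕ, ∀ N : ℕ, N₀ ≤ N →
      (N.factorial : ℝ) * (1 - C * Real.log N / ((N : ℝ) * Real.log (Real.log N)))
        ≤ ((Nat.card {π : Equiv.Perm (Fin N) //
            ∀ k ∈ Finset.Icc 1 (N + 1),
              |((Finset.univ.filter
                  (fun i : Fin N => (i : ℕ) + 1 + ((π i : ℕ) + 1) ≤ k)).card : ℝ)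
                - (k : ℝ) * ((k : ℝ) - 1) / (2 * (N : ℝ))| < ε * (N : ℝ)} : ℕ) : ℝ) := by
  classical
  refine ⟨16 * (3 + ε) / ε ^ 3, by positivity, 3, fun N hN => ?_⟩
  have hN0 : 0 < N := by omega
  have hN3 : (3 : ℝ) ≤ N := by exact_mod_cast hN
  have hNpos : (0 : ℝ) < N := by linarith
  have hlog : 1 < Real.log N := by
    rw [Real.lt_log_iff_exp_lt hNpos]
    linarith [Real.exp_one_lt_d9]
  have hloglog : 0 < Real.log (Real.log N) := Real.log_pos hlog
  have hratio : 1 ≤ Real.log N / Real.log (Real.log N) := by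
    rw [one_le_div hloglog]
    exact Real.log_le_self (by linarith)
  let P : Equiv.Perm (Fin N) → Prop := fun π => ∀ k ∈ Finset.Icc 1 (N + 1),
    |(cumXRay π k : ℝ) - (k : ℝ) * ((k : ℝ) - 1) / (2 * (N : ℝ))| < ε * (N : ℝ)
  have hbad := card_deviation_mul_le hN0 (δ := ε * N / 2) (by positivity)
    (Finset.univ.filter fun π => ¬ P π) (by
      intro π hπ
      have hπ' := (Finset.mem_filter.1 hπ).2
      simp only [P, not_forall, not_lt] at hπ'
      obtain ⟨k, hk, h⟩ := hπ'
      obtain ⟨hk1, hk2⟩ := Finset.mem_Icc.1 hk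
      refine ⟨k, hk2, ?_⟩
      obtain ⟨t, rfl⟩ := Nat.exists_eq_add_of_le' hk1
      have hg : (gridCount N (t + 1) : ℝ) * 2 = (t + 1) * t := by
        exact_mod_cast gridCount_mul_two (Nat.le_of_succ_le_succ hk2)
      have he : ((t + 1 : ℕ) : ℝ) * (((t + 1 : ℕ) : ℝ) - 1) / (2 * (N : ℝ))
          = gridCount N (t + 1) / N := by
        rw [div_eq_div_iff (by positivity) (by positivity)]
        push_cast
        linear_combination (-(N : ℝ)) * hg
      rw [he] at h
      linarith)
  have hsum : ((Finset.univ.filter P).card : ℝ) + (Finset.univ.filter fun π => ¬ P π).card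
      = N.factorial := by
    rw [← Nat.cast_add, Finset.card_filter_add_card_filter_not, Finset.card_univ,
      Fintype.card_perm, Fintype.card_fin]
  have hcard : Nat.card {π : Equiv.Perm (Fin N) // P π} = (Finset.univ.filter P).card := by
    rw [Nat.card_eq_fintype_card, Fintype.card_subtype]
  change _ ≤ ((Nat.card {π : Equiv.Perm (Fin N) // P π} : ℕ) : ℝ)
  rw [hcard]
  set b : ℝ := ((Finset.univ.filter fun π => ¬ P π).card : ℝ)
  have hF : (0 : ℝ) < N.factorial := by exact_mod_cast N.factorial_pos
  have hb : b ≤ N.factorial * (16 * (3 + ε) / ε ^ 3 / N) := by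
    have h1 : b * (ε * N / 2) ^ 3 ≤ (3 + ε) * N * (2 * N * N.factorial) := by
      refine hbad.trans ?_
      gcongr
      nlinarith [mul_pos hε hNpos]
    have h2 : (N.factorial : ℝ) * (16 * (3 + ε) / ε ^ 3 / N)
        = (3 + ε) * N * (2 * N * N.factorial) / (ε * N / 2) ^ 3 := by
      field_simp
      ring
    rw [h2, le_div_iff₀ (by positivity)]
    exact h1
  have hC : 16 * (3 + ε) / ε ^ 3 / N
      ≤ 16 * (3 + ε) / ε ^ 3 * Real.log N / ((N : ℝ) * Real.log (Real.log N)) := by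
    rw [mul_div_mul_comm]
    exact le_mul_of_one_le_right (by positivity) hratio
  nlinarith [mul_le_mul_of_nonneg_left hC hF.le]
end
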